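/- Let e and f be properly infinite, equidimensional projections in an AW*-algebra A. Then e ≼ f if and only if c(e) ≤ c(f) and d(e) ≤ d(f); consequently e ∼ f if and only if c(e) = c(f) and d(e) = d(f). -/

import Mathlib

universe u

section Defs

variable {R : Type u} [Ring R] [StarRing R]

/-- An element is a projection if it is self-adjoint and idempotent. -/
def IsProjection (p : R) : Prop := star p = p ∧ p * p = p

/-- Order on projections: `e ≤ f` iff `e = ef`. -/
def ProjLE (e f : R) : Prop := e * f = e

/-- Murray–von Neumann equivalence of projections. -/
def ProjEquiv (e f : R) : Prop := ∃ v : R, star v * v = e ∧ v * star v = f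

/-- `e ≼ f` : `e` is equivalent to a subprojection of `f`. -/
def ProjSubEquiv (e f : R) : Prop :=
  ∃ e' : R, IsProjection e' ∧ ProjLE e' f ∧ ProjEquiv e e'

/-- `e ≺ f` : `e ≼ f` but `e` is not equivalent to `f` (with the convention `0 ≺ 0`). -/
def ProjLT (e f : R) : Prop :=
  (ProjSubEquiv e f ∧ ¬ ProjEquiv e f) ∨ (e = 0 ∧ f = 0)

/-- A central projection. -/
def IsCentralProj (z : R) : Prop := IsProjection z ∧ ∀ a : R, z * a = a * z

/-- `c` is the central cover of `e`: the least central projection above `e`. -/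
def IsCentralCover (e c : R) : Prop :=
  IsCentralProj c ∧ ProjLE e c ∧
    ∀ z : R, IsCentralProj z → ProjLE e z → ProjLE c z

/-- A projection `e` is finite if `e ∼ f ≤ e` implies `f = e`. -/
def ProjFinite (e : R) : Prop :=
  ∀ f : R, IsProjection f → ProjEquiv e f → ProjLE f e → f = e

/-- A nonzero projection is properly infinite if `ze` is infinite
for every central projection `z` with `ze ≠ 0`. -/
def ProperlyInfinite (e : R) : Prop :=
  IsProjection e ∧ e ≠ 0 ∧
    ∀ z : R, IsCentralProj z → z * e ≠ 0 → ¬ ProjFinite (z * e)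

/-- A pairwise orthogonal family of elements. -/
def PairwiseOrthogonal {ι : Type*} (p : ι → R) : Prop :=
  ∀ i j, i ≠ j → p i * p j = 0

/-- `s` is the supremum of the family `p` in the projection order. For an
orthogonal family, this is the sum `Σ pᵢ`. -/
def IsSupProj {ι : Type*} (p : ι → R) (s : R) : Prop :=
  IsProjection s ∧ (∀ i, ProjLE (p i) s) ∧
    ∀ t : R, IsProjection t → (∀ i, ProjLE (p i) t) → ProjLE s t

/-- The family `p` belongs to `Γ(e)`: an orthogonal family of projections,
each equivalent to `e`, with sum (supremum) `e`. -/
def InGamma (e : R) {ι : Type u} (p : ι → R) : Prop :=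
  (∀ i, IsProjection (p i)) ∧ PairwiseOrthogonal p ∧
    (∀ i, ProjEquiv (p i) e) ∧ IsSupProj p e

open Classical in
/-- The dimension `d(e)` of a properly infinite projection: the least cardinal
strictly greater than the cardinality of the index set of every family in
`Γ(e)`, with the convention `d(0) = 0`. -/
noncomputable def projDim (e : R) : Cardinal.{u} :=
  if e = 0 then 0
  else sSup {c : Cardinal.{u} |
    ∃ (ι : Type u) (p : ι → R), InGamma e p ∧ c = Order.succ (Cardinal.mk ι)}

/-- A properly infinite projection `e` is equidimensional if `d(ze) = d(e)`
for every central projection `z` with `ze ≠ 0` (equivalently, for every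
nonzero central projection `z ≤ c(e)`). -/
def Equidimensional (e : R) : Prop :=
  ProperlyInfinite e ∧
    ∀ z : R, IsCentralProj z → z * e ≠ 0 → projDim (z * e) = projDim e

/-- An abelian projection: the corner `eRe` is commutative. -/
def IsAbelianProj (e : R) : Prop :=
  IsProjection e ∧ ∀ a b : R, (e * a * e) * (e * b * e) = (e * b * e) * (e * a * e)

/-- `j` is the join `e ∨ f` in the projection lattice. -/
def IsJoinProj (e f j : R) : Prop :=
  IsProjection j ∧ ProjLE e j ∧ ProjLE f j ∧
    ∀ t : R, IsProjection t → ProjLE e t → ProjLE f t → ProjLE j t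

end Defs

/-- The AW*-condition: the right annihilator of any subset is generated by a
projection: `{a | ∀ s ∈ S, s a = 0} = pR`. -/
def IsAWStarRing (R : Type*) [Ring R] [StarRing R] : Prop :=
  ∀ S : Set R, ∃ p : R, IsProjection p ∧
    {a : R | ∀ s ∈ S, s * a = 0} = {a : R | ∃ b : R, a = p * b}

/-- A maximal abelian (*-sub)algebra. -/
def IsMaximalAbelian {A : Type*} [Ring A] [StarRing A] [Algebra ℂ A] [StarModule ℂ A]
    (M : StarSubalgebra ℂ A) : Prop :=
  (∀ x ∈ M, ∀ y ∈ M, x * y = y * x) ∧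
    ∀ N : StarSubalgebra ℂ A, (∀ x ∈ N, ∀ y ∈ N, x * y = y * x) → M ≤ N → M = N

section Part1
namespace AWS

variable {A : Type u} [CStarAlgebra A]

lemma proj_one_sub {p : A} (hp : IsProjection p) : IsProjection (1 - p) := by
  refine ⟨by simp [hp.1], ?_⟩
  simp [mul_sub, sub_mul, hp.2]

lemma le_symm {p q : A} (hp : IsProjection p) (hq : IsProjection q) (h : p * q = p) :
    q * p = p := by
  have := congrArg star h
  simpa [hp.1, hq.1] using this

lemma orth_symm {p q : A} (hp : IsProjection p) (hq : IsProjection q) (h : p * q = 0) :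
    q * p = 0 := by
  have := congrArg star h
  simpa [hp.1, hq.1] using this

lemma proj_sub {p q : A} (hp : IsProjection p) (hq : IsProjection q) (h : p * q = p) :
    IsProjection (q - p) := by
  refine ⟨by simp [hp.1, hq.1], ?_⟩
  simp [mul_sub, sub_mul, hp.2, hq.2, h, le_symm hp hq h]

lemma proj_add {p q : A} (hp : IsProjection p) (hq : IsProjection q) (h : p * q = 0) :
    IsProjection (p + q) := by
  refine ⟨by simp [hp.1, hq.1], ?_⟩
  simp [mul_add, add_mul, hp.2, hq.2, h, orth_symm hp hq h]

lemma pi_right {v e : A} (he : IsProjection e) (h : star v * v = e) : v * e = v := by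
  rw [← sub_eq_zero, ← CStarRing.star_mul_self_eq_zero_iff]
  have h2 := he.2
  have : star (v * e - v) * (v * e - v) = e * (star v * v) * e - e * (star v * v)
      - (star v * v) * e + star v * v := by
    simp [he.1]; noncomm_ring
  rw [this, h]; simp [h2]

lemma pi_proj {v e : A} (he : IsProjection e) (h : star v * v = e) :
    IsProjection (v * star v) := by
  refine ⟨by simp, ?_⟩
  calc v * star v * (v * star v) = v * (star v * v) * star v := by noncomm_ring
    _ = v * star v := by rw [h, pi_right he h]

/-- subequivalence through a partial isometry -/
lemma sub_iff {e f : A} (he : IsProjection e) (hf : IsProjection f) :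
    ProjSubEquiv e f ↔ ∃ v, star v * v = e ∧ f * v = v := by
  constructor
  · rintro ⟨e', he', hle, v, h1, h2⟩
    refine ⟨v, h1, ?_⟩
    have : e' * v = v := by
      rw [← h2, mul_assoc, h1, pi_right he h1]
    rw [← this, ← mul_assoc, le_symm he' hf hle]
  · rintro ⟨v, h1, h2⟩
    refine ⟨v * star v, pi_proj he h1, ?_, v, h1, rfl⟩
    have := congrArg star h2
    simp only [star_mul, hf.1] at this
    rw [ProjLE, mul_assoc, this]

lemma eqv_data {e f : A} (he : IsProjection e) (h : ProjEquiv e f) :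
    ∃ v, star v * v = e ∧ v * star v = f ∧ v * e = v ∧ f * v = v ∧ e * star v = star v ∧
      star v * f = star v ∧ IsProjection f := by
  obtain ⟨v, h1, h2⟩ := h
  have h3 := pi_right he h1
  have h4 : f * v = v := by rw [← h2, mul_assoc, h1, h3]
  have hf : IsProjection f := h2 ▸ pi_proj he h1
  refine ⟨v, h1, h2, h3, h4, ?_, ?_, hf⟩
  · simpa [he.1] using congrArg star h3
  · simpa [hf.1] using congrArg star h4

lemma eqv_refl {e : A} (he : IsProjection e) : ProjEquiv e e := ⟨e, by rw [he.1, he.2], by rw [he.1, he.2]⟩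

lemma eqv_symm {e f : A} (h : ProjEquiv e f) : ProjEquiv f e := by
  obtain ⟨v, h1, h2⟩ := h
  exact ⟨star v, by simpa using h2, by simpa using h1⟩

lemma eqv_trans {e f g : A} (he : IsProjection e) (h : ProjEquiv e f) (h' : ProjEquiv f g) :
    ProjEquiv e g := by
  obtain ⟨v, h1, h2, h3, h4, h5, h6, hf⟩ := eqv_data he h
  obtain ⟨w, k1, k2, k3, k4, k5, k6, hg⟩ := eqv_data hf h'
  refine ⟨w * v, ?_, ?_⟩
  · calc star (w * v) * (w * v) = star v * (star w * w) * v := by simp [mul_assoc]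
      _ = e := by rw [k1, h6, h1]
  · calc w * v * star (w * v) = w * (v * star v) * star w := by simp [mul_assoc]
      _ = g := by rw [h2, k3, k2]

lemma eqv_add {a b a' b' : A} (ha : IsProjection a) (hb : IsProjection b)
    (hab : a * b = 0) (hab' : a' * b' = 0) (h : ProjEquiv a a') (h' : ProjEquiv b b') :
    ProjEquiv (a + b) (a' + b') := by
  obtain ⟨v, h1, h2, h3, h4, h5, h6, ha'⟩ := eqv_data ha h
  obtain ⟨w, k1, k2, k3, k4, k5, k6, hb'⟩ := eqv_data hb h'
  have e1 : star v * w = 0 := by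
    calc star v * w = (star v * a') * (b' * w) := by rw [h6, k4]
      _ = star v * (a' * b') * w := by noncomm_ring
      _ = 0 := by rw [hab']; simp
  have e2 : v * star w = 0 := by
    calc v * star w = (v * a) * (b * star w) := by rw [h3, k5]
      _ = v * (a * b) * star w := by noncomm_ring
      _ = 0 := by rw [hab]; simp
  have e3 : star w * v = 0 := by simpa using congrArg star e1
  have e4 : w * star v = 0 := by simpa using congrArg star e2
  exact ⟨v + w, by simp [mul_add, add_mul, e1, e3, h1, k1], by simp [mul_add, add_mul, e2, e4, h2, k2]⟩

lemma eqv_zero {e : A} (h : ProjEquiv e 0) : e = 0 := by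
  obtain ⟨v, h1, h2⟩ := h
  have : v = 0 := (CStarRing.mul_star_self_eq_zero_iff v).1 h2
  rw [← h1, this]; simp

lemma cproj_mul {z e : A} (hz : IsCentralProj z) (he : IsProjection e) : IsProjection (z * e) := by
  refine ⟨by simp [hz.1.1, he.1, hz.2], ?_⟩
  calc z * e * (z * e) = z * (e * z) * e := by noncomm_ring
    _ = (z * z) * (e * e) := by rw [← hz.2]; noncomm_ring
    _ = z * e := by rw [hz.1.2, he.2]

lemma central_mul {z y : A} (hz : IsCentralProj z) (hy : IsCentralProj y) :
    IsCentralProj (z * y) :=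
  ⟨cproj_mul hz hy.1, fun a => by rw [mul_assoc, hy.2, ← mul_assoc, hz.2, mul_assoc]⟩

lemma central_one_sub {z : A} (hz : IsCentralProj z) : IsCentralProj (1 - z) :=
  ⟨proj_one_sub hz.1, fun a => by rw [sub_mul, mul_sub, hz.2]; simp⟩

lemma central_one : IsCentralProj (1 : A) := ⟨⟨by simp, by simp⟩, by simp⟩

lemma eqv_cut {z e f : A} (hz : IsCentralProj z) (h : ProjEquiv e f) :
    ProjEquiv (z * e) (z * f) := by
  obtain ⟨v, h1, h2⟩ := h
  have c := hz.2
  refine ⟨z * v, ?_, ?_⟩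
  · calc star (z * v) * (z * v) = star v * (z * z) * v := by simp [hz.1.1]; noncomm_ring
      _ = z * e := by rw [hz.1.2, ← c, mul_assoc, h1]
  · calc z * v * star (z * v) = z * (v * star v * z) := by simp [hz.1.1]; noncomm_ring
      _ = z * f := by rw [← c, ← mul_assoc, hz.1.2, h2]

lemma sub_cut {z e f : A} (hz : IsCentralProj z)
    (h : ProjSubEquiv e f) : ProjSubEquiv (z * e) (z * f) := by
  obtain ⟨e', he', hl, h⟩ := h
  refine ⟨z * e', cproj_mul hz he', ?_, eqv_cut hz h⟩
  calc z * e' * (z * f) = z * (e' * z) * f := by noncomm_ring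
    _ = (z * z) * (e' * f) := by rw [← hz.2]; noncomm_ring
    _ = z * e' := by rw [hz.1.2, hl]

lemma sub_trans {e f g : A} (he : IsProjection e) (hf : IsProjection f) (hg : IsProjection g)
    (h : ProjSubEquiv e f) (h' : ProjSubEquiv f g) : ProjSubEquiv e g := by
  rw [sub_iff he hf] at h
  rw [sub_iff hf hg] at h'
  rw [sub_iff he hg]
  obtain ⟨v, h1, h2⟩ := h
  obtain ⟨w, k1, k2⟩ := h'
  refine ⟨w * v, ?_, by rw [← mul_assoc, k2]⟩
  calc star (w * v) * (w * v) = star v * ((star w * w) * v) := by simp [mul_assoc]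
      _ = e := by rw [k1, h2, h1]

lemma sub_of_eqv {e f : A} (he : IsProjection e) (h : ProjEquiv e f) : ProjSubEquiv e f := by
  obtain ⟨v, h1, h2, h3, h4, h5, h6, hf⟩ := eqv_data he h
  exact ⟨f, hf, hf.2, h⟩

lemma sub_of_le {e f : A} (he : IsProjection e) (h : e * f = e) : ProjSubEquiv e f :=
  ⟨e, he, h, eqv_refl he⟩

lemma sub_add {a b a' b' : A} (ha : IsProjection a) (hb : IsProjection b)
    (ha' : IsProjection a') (hb' : IsProjection b')
    (hab : a * b = 0) (hab' : a' * b' = 0) (h : ProjSubEquiv a a') (h' : ProjSubEquiv b b') :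
    ProjSubEquiv (a + b) (a' + b') := by
  obtain ⟨p, hp, hpl, hp2⟩ := h
  obtain ⟨q, hq, hql, hq2⟩ := h'
  unfold ProjLE at hpl hql
  have hpq : p * q = 0 := by
    rw [← hpl, ← le_symm hq hb' hql]
    calc p * a' * (b' * q) = p * (a' * b') * q := by noncomm_ring
      _ = 0 := by simp [hab']
  refine ⟨p + q, proj_add hp hq hpq, ?_, eqv_add ha hb hab hpq hp2 hq2⟩
  have e1 : p * b' = 0 := by rw [← hpl, mul_assoc, hab', mul_zero]
  have e2 : q * a' = 0 := by rw [← hql, mul_assoc, orth_symm ha' hb' hab', mul_zero]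
  simp [ProjLE, mul_add, add_mul, hpl, hql, e1, e2]

/-- transport of subprojections -/
lemma transport {v e f p : A} (he : IsProjection e) (h1 : star v * v = e) (h2 : v * star v = f)
    (hp : IsProjection p) (hpe : p * e = p) :
    IsProjection (v * p * star v) ∧ v * p * star v * f = v * p * star v ∧
      ProjEquiv p (v * p * star v) := by
  have h3 : ProjEquiv p (v * p * star v) := by
    refine ⟨v * p, ?_, ?_⟩
    · calc star (v * p) * (v * p) = star p * (star v * v) * p := by simp [mul_assoc]
        _ = p := by rw [h1, hp.1, hpe, hp.2]
    · calc v * p * star (v * p) = v * (p * star p) * star v := by simp [mul_assoc]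
        _ = _ := by rw [hp.1, hp.2]
  obtain ⟨-, -, -, -, -, -, -, h⟩ := eqv_data hp h3
  refine ⟨h, ?_, h3⟩
  rw [← h2]
  calc v * p * star v * (v * star v) = v * (p * (star v * v)) * star v := by noncomm_ring
    _ = _ := by rw [h1, hpe]

/-- algebraic form of suprema -/
def PSum {ι : Type*} (p : ι → A) (s : A) : Prop :=
  IsProjection s ∧ (∀ i, p i * s = p i) ∧ ∀ x, (∀ i, p i * x = 0) → s * x = 0

lemma ann_exists (hAW : IsAWStarRing A) (S : Set A) :
    ∃ s, IsProjection s ∧ (∀ x ∈ S, x * s = x) ∧ ∀ x, (∀ y ∈ S, y * x = 0) → s * x = 0 := by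
  obtain ⟨p, hp, h⟩ := hAW S
  refine ⟨1 - p, proj_one_sub hp, ?_, ?_⟩
  · intro x hx
    have : p ∈ {a : A | ∀ s ∈ S, s * a = 0} := by rw [h]; exact ⟨1, by simp⟩
    rw [mul_sub, this x hx]; simp
  · intro x hx
    have : x ∈ {a : A | ∀ s ∈ S, s * a = 0} := hx
    rw [h] at this
    obtain ⟨b, rfl⟩ := this
    rw [← mul_assoc, sub_mul, hp.2]; simp

lemma psum_exists (hAW : IsAWStarRing A) {ι : Type*} (p : ι → A) : ∃ s, PSum p s := by
  obtain ⟨s, h1, h2, h3⟩ := ann_exists hAW (Set.range p)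
  exact ⟨s, h1, fun i => h2 _ ⟨i, rfl⟩, fun x hx => h3 x (by rintro _ ⟨i, rfl⟩; exact hx i)⟩

lemma le_antisymm' {s t : A} (hs : IsProjection s) (ht : IsProjection t) (h : s * t = s)
    (h' : t * s = t) : s = t := by
  rw [← h, le_symm ht hs h']

lemma psum_unique {ι : Type*} {p : ι → A} {s t : A} (hs : PSum p s) (ht : PSum p t) : s = t := by
  have key : ∀ {s t : A}, PSum p s → PSum p t → s * t = s := by
    intro s t hs ht
    have := hs.2.2 (1 - t) (fun i => by rw [mul_sub, ht.2.1]; simp)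
    rw [mul_sub, mul_one, sub_eq_zero] at this
    exact this.symm
  exact le_antisymm' hs.1 ht.1 (key hs ht) (key ht hs)

lemma psum_le {ι : Type*} {p : ι → A} {s t : A} (hs : PSum p s)
    (h : ∀ i, p i * t = p i) : s * t = s := by
  have := hs.2.2 (1 - t) (fun i => by rw [mul_sub, h]; simp)
  rw [mul_sub, mul_one, sub_eq_zero] at this
  exact this.symm

lemma psum_isSup {ι : Type*} {p : ι → A} {s : A} (hs : PSum p s) : IsSupProj p s :=
  ⟨hs.1, hs.2.1, fun _ _ h => psum_le hs h⟩

lemma isSup_psum (hAW : IsAWStarRing A) {ι : Type*} {p : ι → A} {s : A} (hs : IsSupProj p s) :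
    PSum p s := by
  obtain ⟨t, ht⟩ := psum_exists hAW p
  have : s = t := le_antisymm' hs.1 ht.1 (hs.2.2 t ht.1 ht.2.1) (psum_le ht hs.2.1)
  exact this ▸ ht

/-- left version -/
lemma psum_left {ι : Type*} {p : ι → A} (hp : ∀ i, IsProjection (p i)) {s : A} (hs : PSum p s)
    {x : A} (h : ∀ i, x * p i = 0) : x * s = 0 := by
  have := hs.2.2 (star x) (fun i => by simpa [(hp i).1] using congrArg star (h i))
  simpa [hs.1.1] using congrArg star this

lemma psum_transport {ι : Type*} {p : ι → A} (hp : ∀ i, IsProjection (p i)) {v e f s : A} (he : IsProjection e)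
    (h1 : star v * v = e) (h2 : v * star v = f)
    (hs : PSum p s) (hse : s * e = s) :
    PSum (fun i => v * p i * star v) (v * s * star v) := by
  have h3 := pi_right he h1
  have hpe : ∀ i, p i * e = p i := fun i => by rw [← hs.2.1 i, mul_assoc, hse]
  refine ⟨(transport he h1 h2 hs.1 hse).1, fun i => ?_, fun x hx => ?_⟩
  · calc v * p i * star v * (v * s * star v) = v * (p i * (star v * v) * s) * star v := by noncomm_ring
      _ = _ := by rw [h1, hpe, hs.2.1]
  · have hes : e * s = s := le_symm hs.1 he hse
    have : s * (star v * x) = 0 := by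
      refine hs.2.2 _ fun i => ?_
      have h4 : e * p i * star v * x = 0 := by
        calc e * p i * star v * x = star v * (v * p i * star v * x) := by rw [← h1]; noncomm_ring
          _ = 0 := by rw [hx i]; simp
      rwa [le_symm (hp i) he (hpe i), mul_assoc] at h4
    calc v * s * star v * x = v * (s * (star v * x)) := by noncomm_ring
      _ = 0 := by rw [this]; simp

end AWS

end Part1

section Part2
namespace AWS

variable {A : Type u} [CStarAlgebra A]

lemma proj_half {a b w : A} (ha : IsProjection a) (hb : IsProjection b) (hab : a * b = 0)
    (h1 : star w * w = a) (h2 : w * star w = b) :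
    ∃ g, IsProjection g ∧ g + g = a + b + w + star w ∧ g * (a + b) = g := by
  obtain ⟨hwa, hbw⟩ : w * a = w ∧ b * w = w := by
    have := pi_right ha h1
    exact ⟨this, by rw [← h2, mul_assoc, h1, this]⟩
  have hba := orth_symm ha hb hab
  have k1 : a * star w = star w := by simpa [ha.1] using congrArg star hwa
  have k2 : star w * b = star w := by simpa [hb.1] using congrArg star hbw
  have k3 : w * w = 0 := by
    calc w * w = (w * a) * (b * w) := by rw [hwa, hbw]
      _ = w * (a * b) * w := by noncomm_ring
      _ = 0 := by simp [hab]
  have k4 : star w * star w = 0 := by simpa using congrArg star k3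
  have k5 : a * w = 0 := by rw [← hbw, ← mul_assoc, hab, zero_mul]
  have k6 : w * b = 0 := by rw [← hwa, mul_assoc, hab, mul_zero]
  have k7 : star w * a = 0 := by simpa [ha.1] using congrArg star k5
  have k8 : b * star w = 0 := by simpa [hb.1] using congrArg star k6
  have key : (a + b + w + star w) * (a + b + w + star w) =
      (a + b + w + star w) + (a + b + w + star w) := by
    simp only [mul_add, add_mul, ha.2, hb.2, hab, hba, h1, h2, hwa, hbw, k1, k2, k3, k4, k5, k6, k7, k8]
    abel
  refine ⟨(2⁻¹ : ℂ) • (a + b + w + star w), ⟨?_, ?_⟩, ?_, ?_⟩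
  · simp only [star_smul, star_add, star_star, ha.1, hb.1]
    have : star (2⁻¹ : ℂ) = 2⁻¹ := by simp
    rw [this]; congr 1; abel
  · rw [smul_mul_smul_comm, key, ← two_smul ℂ, smul_smul]; norm_num
  · rw [← two_smul ℂ, smul_smul]; norm_num
  · rw [smul_mul_assoc]; congr 1
    simp only [mul_add, add_mul, ha.2, hb.2, hab, hba, hwa, k2, k6, k7]
    abel

/-- orthogonal additivity of equivalence -/
lemma add_orth (hAW : IsAWStarRing A) {ι : Type*} {a b : ι → A} (ha : ∀ i, IsProjection (a i))
    (hb : ∀ i, IsProjection (b i)) (hao : PairwiseOrthogonal a) (hbo : PairwiseOrthogonal b)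
    (hab : ∀ i j, a i * b j = 0) (h : ∀ i, ProjEquiv (a i) (b i)) {s t : A}
    (hs : PSum a s) (ht : PSum b t) : ProjEquiv s t := by
  have hba : ∀ i j, b i * a j = 0 := fun i j => orth_symm (ha j) (hb i) (hab j i)
  choose w h1 h2 using h
  choose g hg hgc hgq using fun i => proj_half (ha i) (hb i) (hab i i) (h1 i) (h2 i)
  have hqg : ∀ i, (a i + b i) * g i = g i := fun i => by
    simpa [(ha i).1, (hb i).1, (hg i).1] using congrArg star (hgq i)
  have hwa : ∀ i, w i * a i = w i := fun i => pi_right (ha i) (h1 i)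
  have hbw : ∀ i, b i * w i = w i := fun i => by rw [← h2, mul_assoc, h1, hwa]
  obtain ⟨G, hG⟩ := psum_exists hAW g
  have hGq : ∀ j, G * (a j + b j) = g j := by
    intro j
    have : G * ((a j + b j) - g j) = 0 := by
      refine hG.2.2 _ fun i => ?_
      by_cases hij : i = j
      · subst hij; rw [mul_sub, hgq, (hg i).2, sub_self]
      · have e1 : (a i + b i) * (a j + b j) = 0 := by
          simp [mul_add, add_mul, hab, hba, hao i j hij, hbo i j hij]
        have e2 : g i * (a j + b j) = 0 := by rw [← hgq i, mul_assoc, e1, mul_zero]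
        have e3 : g i * g j = 0 := by rw [← hqg j, ← mul_assoc, e2, zero_mul]
        rw [mul_sub, e2, e3, sub_zero]
    rw [mul_sub, le_symm (hg j) hG.1 (hG.2.1 j), sub_eq_zero] at this
    exact this
  have hqG : ∀ j, (a j + b j) * G = g j := fun j => by
    simpa [(ha j).1, (hb j).1, (hg j).1, hG.1.1] using congrArg star (hGq j)
  have hsa : ∀ j, s * a j = a j := fun j => le_symm (ha j) hs.1 (hs.2.1 j)
  have htb : ∀ j, t * b j = b j := fun j => le_symm (hb j) ht.1 (ht.2.1 j)
  have hta : ∀ j, t * a j = 0 := fun j => ht.2.2 _ fun i => hba i j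
  have hsb : ∀ j, s * b j = 0 := fun j => hs.2.2 _ fun i => hab i j
  have hbs : ∀ j, b j * s = 0 := fun j => orth_symm hs.1 (hb j) (hsb j)
  set W := t * (G + G) * s with hW
  have hWa : ∀ j, W * a j = w j := by
    intro j
    have e0 : (a j + b j) * a j = a j := by simp [add_mul, (ha j).2, hba]
    have e1 : (G + G) * a j = (g j + g j) * a j := by
      nth_rewrite 1 [← e0]
      rw [← mul_assoc, add_mul G G, hGq]
    have e2 : star (w j) * a j = 0 := by
      have : a j * w j = 0 := by rw [← hbw, ← mul_assoc, hab, zero_mul]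
      simpa [(ha j).1] using congrArg star this
    calc W * a j = t * ((G + G) * (s * a j)) := by rw [hW]; noncomm_ring
      _ = t * (a j + w j) := by
        rw [hsa, e1, hgc]; simp [add_mul, (ha j).2, hba, hwa, e2]
      _ = w j := by rw [mul_add, hta, ← hbw, ← mul_assoc, htb]; simp
  have hbW : ∀ j, b j * W = w j := by
    intro j
    have e0 : b j * (a j + b j) = b j := by simp [mul_add, (hb j).2, hba]
    have e1 : b j * (G + G) = b j * (g j + g j) := by
      nth_rewrite 1 [← e0]
      rw [mul_assoc, mul_add _ G G, hqG]
    have e2 : b j * star (w j) = 0 := by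
      have : w j * b j = 0 := by rw [← hwa, mul_assoc, hab, mul_zero]
      simpa [(hb j).1] using congrArg star this
    calc b j * W = ((b j * t) * (G + G)) * s := by rw [hW]; noncomm_ring
      _ = (b j + w j) * s := by
        rw [ht.2.1, e1, hgc]; simp [mul_add, (hb j).2, hba, hbw, e2]
      _ = w j := by rw [add_mul, hbs, ← hwa, mul_assoc, hs.2.1]; simp
  have hWb : ∀ j, star W * b j = star (w j) := fun j => by
    simpa [(hb j).1] using congrArg star (hbW j)
  refine ⟨W, ?_, ?_⟩
  · have : (star W * W - s) * s = 0 := by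
      refine psum_left ha hs fun j => ?_
      rw [sub_mul, mul_assoc, hWa, hsa, ← hbw, ← mul_assoc, hWb, h1, sub_self]
    have e : W * s = W := by rw [hW, mul_assoc, hs.1.2]
    rwa [sub_mul, mul_assoc, e, hs.1.2, sub_eq_zero] at this
  · have : (W * star W - t) * t = 0 := by
      refine psum_left hb ht fun j => ?_
      have e3 : a j * star (w j) = star (w j) := by simpa [(ha j).1] using congrArg star (hwa j)
      rw [sub_mul, mul_assoc, hWb, htb, ← e3, ← mul_assoc, hWa, h2, sub_self]
    have e : star W * t = star W := by rw [hW]; simp [ht.1.1, ht.1.2, mul_assoc]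
    rwa [sub_mul, mul_assoc, e, ht.1.2, sub_eq_zero] at this

/-- the sequence of shifted projections -/
lemma shift_seq {v F D : A} (hF : IsProjection F) (h1 : star v * v = F) (hFv : F * v = v)
    (hD : IsProjection D) (hDF : D * F = D) (hDv : D * v = 0) :
    ∃ p : ℕ → A, p 0 = D ∧ (∀ n, p (n + 1) = v * p n * star v) ∧ (∀ n, IsProjection (p n)) ∧
      (∀ n, p n * F = p n) ∧ PairwiseOrthogonal p ∧ ∀ n, ProjEquiv D (p n) := by
  have hFV : ∀ n, F * (v ^ n * D) = v ^ n * D := by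
    intro n
    cases n with
    | zero => simp [le_symm hD hF hDF]
    | succ n => rw [pow_succ', ← mul_assoc, ← mul_assoc, hFv]
  have hVV : ∀ n, star (v ^ n * D) * (v ^ n * D) = D := by
    intro n
    induction n with
    | zero => simp [hD.1, hD.2]
    | succ n ih =>
      calc star (v ^ (n+1) * D) * (v ^ (n+1) * D)
        = star (v ^ n * D) * ((star v * v) * (v ^ n * D)) := by rw [pow_succ']; simp [mul_assoc]
        _ = D := by rw [h1, hFV, ih]
  have hVo : ∀ m n, m < n → star (v ^ m * D) * (v ^ n * D) = 0 := by
    intro m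
    induction m with
    | zero =>
      intro n hn
      obtain ⟨k, rfl⟩ := Nat.exists_eq_succ_of_ne_zero hn.ne'
      rw [Nat.succ_eq_add_one, pow_succ']
      calc star (v ^ 0 * D) * (v * v ^ k * D) = (D * v) * (v ^ k * D) := by simp [hD.1, mul_assoc]
        _ = 0 := by rw [hDv, zero_mul]
    | succ m ih =>
      intro n hn
      obtain ⟨k, rfl⟩ := Nat.exists_eq_succ_of_ne_zero (Nat.ne_of_gt (Nat.lt_of_le_of_lt (Nat.zero_le _) hn))
      calc star (v ^ (m+1) * D) * (v ^ (k+1) * D)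
        = star (v ^ m * D) * ((star v * v) * (v ^ k * D)) := by
            rw [pow_succ', pow_succ']; simp [mul_assoc]
        _ = 0 := by rw [h1, hFV, ih k (by omega)]
  have hVo' : ∀ m n, m ≠ n → star (v ^ m * D) * (v ^ n * D) = 0 := by
    intro m n hmn
    rcases lt_or_gt_of_ne hmn with h | h
    · exact hVo m n h
    · simpa [mul_assoc] using congrArg star (hVo n m h)
  refine ⟨fun n => (v ^ n * D) * star (v ^ n * D), by simp [hD.1, hD.2], ?_,
    fun n => pi_proj hD (hVV n), ?_, ?_, fun n => ⟨_, hVV n, rfl⟩⟩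
  · intro n; simp [pow_succ', mul_assoc]
  · intro n
    have := congrArg star (hFV n)
    rw [star_mul, hF.1] at this
    dsimp only
    rw [mul_assoc, this]
  · intro m n hmn
    calc (v ^ m * D) * star (v ^ m * D) * ((v ^ n * D) * star (v ^ n * D))
      = (v ^ m * D) * (star (v ^ m * D) * (v ^ n * D)) * star (v ^ n * D) := by noncomm_ring
      _ = 0 := by rw [hVo' m n hmn]; simp

/-- Schroeder–Bernstein, special case -/
lemma sb_le (hAW : IsAWStarRing A) {F G : A} (hF : IsProjection F) (hG : IsProjection G)
    (hGF : G * F = G) (h : ProjSubEquiv F G) : ProjEquiv F G := by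
  obtain ⟨v, h1, h2⟩ := (sub_iff hF hG).1 h
  have hFG := le_symm hG hF hGF
  have hFv : F * v = v := by rw [← h2, ← mul_assoc, hFG]
  have hD := proj_sub hG hF hGF
  have hDF : (F - G) * F = F - G := by rw [sub_mul, hF.2, hGF]
  have hDv : (F - G) * v = 0 := by rw [sub_mul, hFv, h2, sub_self]
  obtain ⟨p, p0, ps, pp, pF, po, -⟩ := shift_seq hF h1 hFv hD hDF hDv
  obtain ⟨E, hE⟩ := psum_exists hAW p
  have hEF : E * F = E := psum_le hE pF
  have T := psum_transport pp hF h1 rfl hE hEF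
  have T' := transport hF h1 rfl hE.1 hEF
  have hDT : (F - G) * (v * E * star v) = 0 := by rw [mul_assoc, ← mul_assoc, hDv, zero_mul]
  have hE' : E = (F - G) + v * E * star v := by
    refine psum_unique hE ⟨proj_add hD T'.1 hDT, ?_, ?_⟩
    · intro n
      cases n with
      | zero => rw [p0, mul_add, hDT, hD.2, add_zero]
      | succ n =>
        have := po (n+1) 0 (by omega)
        rw [p0] at this
        rw [mul_add, this, zero_add, ps]
        exact T.2.1 n
    · intro x hx
      rw [add_mul, ← p0, hx 0, zero_add]
      refine T.2.2 x fun n => ?_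
      have := hx (n + 1)
      rwa [ps] at this
  have hT : v * E * star v = E - (F - G) := by rw [eq_sub_iff_add_eq, add_comm]; exact hE'.symm
  have o1 : E * (F - E) = 0 := by rw [mul_sub, hEF, hE.1.2, sub_self]
  have o2 : (v * E * star v) * (F - E) = 0 := by
    have : (v * E * star v) * E = v * E * star v := by
      nth_rewrite 2 [hE']
      rw [mul_add, orth_symm hD T'.1 hDT, zero_add, T'.1.2]
    rw [← this, mul_assoc, o1, mul_zero]
  have := eqv_add hE.1 (proj_sub hE.1 hF hEF) o1 o2 T'.2.2 (eqv_refl (proj_sub hE.1 hF hEF))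
  rw [hT] at this
  convert this using 1 <;> abel

lemma sb (hAW : IsAWStarRing A) {e f : A} (he : IsProjection e) (hf : IsProjection f)
    (h : ProjSubEquiv e f) (h' : ProjSubEquiv f e) : ProjEquiv e f := by
  obtain ⟨f', hf', hl, hff⟩ := h'
  have : ProjEquiv e f' :=
    sb_le hAW he hf' hl (sub_trans he hf hf' h (sub_of_eqv hf hff))
  exact eqv_trans he this (eqv_symm hff)

end AWS

end Part2

section Part3
namespace AWS

variable {A : Type u} [CStarAlgebra A]

lemma cm (a : A) {f g h : ℝ → ℝ} (hf : Continuous f) (hg : Continuous g)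
    (hh : ∀ r, f r * g r = h r) : cfc f a * cfc g a = cfc h a := by
  rw [← cfc_mul f g a hf.continuousOn hg.continuousOn]
  exact cfc_congr fun r _ => hh r

lemma ca (a : A) {f g h : ℝ → ℝ} (hf : Continuous f) (hg : Continuous g)
    (hh : ∀ r, f r + g r = h r) : cfc f a + cfc g a = cfc h a := by
  rw [← cfc_add a f g hf.continuousOn hg.continuousOn]
  exact cfc_congr fun r _ => hh r

lemma cs (a : A) {f g h : ℝ → ℝ} (hf : Continuous f) (hg : Continuous g)
    (hh : ∀ r, f r - g r = h r) : cfc f a - cfc g a = cfc h a := by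
  rw [← cfc_sub f g a hf.continuousOn hg.continuousOn]
  exact cfc_congr fun r _ => hh r

/-- nonzero equivalent subprojections -/
lemma exists_sub_equiv (hAW : IsAWStarRing A) {e f : A} (he : IsProjection e) (hf : IsProjection f)
    {c : A} (hc : e * c * f ≠ 0) :
    ∃ a b, IsProjection a ∧ IsProjection b ∧ a * e = a ∧ b * f = b ∧ a ≠ 0 ∧ ProjEquiv a b := by
  set x := e * c * f with hx
  set a := star x * x with ha
  have hsa : IsSelfAdjoint a := IsSelfAdjoint.star_mul_self x
  have hnt : Nontrivial A := ⟨_, _, hc⟩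
  have ha0 : a ≠ 0 := fun h => hc ((CStarRing.star_mul_self_eq_zero_iff x).1 h)
  obtain ⟨t, hts, ht0⟩ : ∃ t ∈ spectrum ℝ a, t ≠ 0 := by
    by_contra! h
    apply ha0
    rw [← cfc_id ℝ a, ← cfc_zero ℝ a]
    exact cfc_congr fun t ht => by simpa using h t ht
  have htp : 0 < t := lt_of_le_of_ne (spectrum_star_mul_self_nonneg t hts) ht0.symm
  set ε := t / 2 with hε
  have hεp : 0 < ε := by positivity
  have hmp : ∀ r : ℝ, 0 < max r ε := fun r => lt_max_of_lt_right hεp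
  have hcont : Continuous fun r : ℝ => (√(max r ε))⁻¹ :=
    Continuous.inv₀ (by fun_prop) fun r => (Real.sqrt_pos.2 (hmp r)).ne'
  have hcont2 : Continuous fun r : ℝ => max (r - ε) 0 * (max r ε)⁻¹ :=
    Continuous.mul (by fun_prop) (Continuous.inv₀ (by fun_prop) fun r => (hmp r).ne')
  set y := cfc (fun r : ℝ => (√(max r ε))⁻¹) a with hy
  set q := cfc (fun r : ℝ => max (r - ε) 0) a with hq
  set k := cfc (fun r : ℝ => max (r - ε) 0 * (max r ε)⁻¹) a with hk
  have hqsa : star q = q := cfc_predicate (R := ℝ) _ a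
  have hysa : star y = y := cfc_predicate (R := ℝ) _ a
  have hq0 : q ≠ 0 := by
    intro h
    rw [hq, ← cfc_zero ℝ a] at h
    have := eqOn_of_cfc_eq_cfc h (by fun_prop) (by fun_prop) hsa hts
    simp at this
    linarith
  have haid : cfc (fun r : ℝ => r) a = a := cfc_id' ℝ a
  have hyay : q * (y * a * y) = q := by
    have h1 : y * a * y = cfc (fun r : ℝ => (√(max r ε))⁻¹ * r * (√(max r ε))⁻¹) a := by
      have h2 : y * a = cfc (fun r : ℝ => (√(max r ε))⁻¹ * r) a := by
        have h3 := cm a (h := fun r : ℝ => (√(max r ε))⁻¹ * r) hcont continuous_id fun r => rfl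
        rwa [cfc_id ℝ a] at h3
      rw [h2]
      exact cm _ (hcont.mul continuous_id) hcont fun r => rfl
    rw [h1]
    refine cm a (by fun_prop) ((hcont.mul continuous_id).mul hcont) fun r => ?_
    rcases le_total r ε with h | h
    · rw [max_eq_right (by linarith : r - ε ≤ 0)]; simp
    · rw [max_eq_left h]
      have hr : 0 < r := by linarith
      have : √r * √r = r := Real.mul_self_sqrt hr.le
      have h0 : √r ≠ 0 := (Real.sqrt_pos.2 hr).ne'
      have : (√r)⁻¹ * r * (√r)⁻¹ = 1 := by field_simp; nlinarith
      rw [this, mul_one]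
  have hqk : q = k * a := by
    rw [← haid]
    refine (cm a hcont2 continuous_id fun r => ?_).symm
    rcases le_total r ε with h | h
    · rw [max_eq_right (by linarith : r - ε ≤ 0)]; simp
    · rw [max_eq_left h]
      have hr : 0 < r := by linarith
      simp only [id]
      field_simp
  have hxf : x * f = x := by rw [hx, mul_assoc, hf.2]
  have hex : e * x = x := by rw [hx, ← mul_assoc, ← mul_assoc, he.2]
  obtain ⟨h, hh, hqh, hann⟩ := ann_exists hAW {q}
  have hqh : q * h = q := hqh q rfl
  have hann : ∀ x, q * x = 0 → h * x = 0 := fun x hx => hann x (by rintro _ rfl; exact hx)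
  have hhf : h * f = h := by
    have : h * (1 - f) = 0 := hann _ (by
      rw [hqk, ha, mul_assoc, mul_assoc, mul_sub, hxf]; simp)
    rw [mul_sub, mul_one, sub_eq_zero] at this
    exact this.symm
  have hg : h * (y * a * y) = h := by
    have : h * (y * a * y - 1) = 0 := hann _ (by rw [mul_sub, hyay]; simp)
    rwa [mul_sub, mul_one, sub_eq_zero] at this
  have hw : star (x * y * h) * (x * y * h) = h := by
    calc star (x * y * h) * (x * y * h) = h * (y * (star x * x) * y) * h := by
          simp [hh.1, hysa, mul_assoc]
      _ = h := by rw [← ha, hg, hh.2]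
  have hp := pi_proj hh hw
  refine ⟨_, h, hp, hh, ?_, hhf, ?_, eqv_symm ⟨_, hw, rfl⟩⟩
  · have : e * (x * y * h) = x * y * h := by rw [← mul_assoc, ← mul_assoc, hex]
    have := congrArg star this
    rw [star_mul, he.1] at this
    rw [mul_assoc, this]
  · intro h0
    have : x * y * h = 0 := (CStarRing.mul_star_self_eq_zero_iff _).1 h0
    rw [this] at hw
    apply hq0
    rw [← hqh, ← hw]; simp

/-- Position decomposition -/
lemma position (hAW : IsAWStarRing A) {e f : A} (he : IsProjection e) (hf : IsProjection f) :
    ∃ s, IsProjection s ∧ s * e = e * s ∧ s * f = f * s ∧ ProjEquiv (e * s) (f * s) ∧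
      f * (e * (1 - s)) = 0 ∧ e * (f * (1 - s)) = 0 := by
  set t := e + f - 1 with ht
  have hts : IsSelfAdjoint t := by
    show star t = t
    simp [ht, he.1, hf.1]
  set m := cfc (fun r : ℝ => √r) (t * t) with hm
  set tp := cfc (fun r : ℝ => max r 0) t with htp
  set tn := cfc (fun r : ℝ => max (-r) 0) t with htn
  have hpsa : star tp = tp := cfc_predicate (R := ℝ) _ t
  have hnsa : star tn = tn := cfc_predicate (R := ℝ) _ t
  have htid : cfc (fun r : ℝ => r) t = t := cfc_id' ℝ t
  have hmt : m = tp + tn := by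
    have : t * t = cfc (fun r : ℝ => r * r) t := by
      nth_rewrite 1 2 [← htid]
      exact cm _ continuous_id continuous_id fun r => rfl
    rw [hm, this, ← cfc_comp' _ _ t (by fun_prop) (by fun_prop)]
    refine (ca t (by fun_prop) (by fun_prop) fun r => ?_).symm
    rw [Real.sqrt_mul_self_eq_abs]
    rcases le_total r 0 with h | h
    · rw [abs_of_nonpos h, max_eq_right h, max_eq_left (by linarith)]; simp
    · rw [abs_of_nonneg h, max_eq_left h, max_eq_right (by linarith)]; simp
  have htt : t = tp - tn := by
    refine htid.symm.trans (cs t (by fun_prop) (by fun_prop) fun r => ?_).symm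
    rcases le_total r 0 with h | h
    · rw [max_eq_right h, max_eq_left (by linarith)]; simp
    · rw [max_eq_left h, max_eq_right (by linarith)]; simp
  have hpn : tp * tn = 0 := by
    rw [← cfc_zero ℝ t]
    refine cm t (by fun_prop) (by fun_prop) fun r => ?_
    rcases le_total r 0 with h | h
    · rw [max_eq_right h]; simp
    · rw [max_eq_right (by linarith : -r ≤ 0)]; simp
  have hte : t * e = f * t := by simp [ht, add_mul, sub_mul, mul_add, mul_sub, he.2, hf.2]
  have htf : t * f = e * t := by simp [ht, add_mul, sub_mul, mul_add, mul_sub, he.2, hf.2]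
  have hme : m * e = e * m := by
    refine Commute.cfc_real ?_ _
    show t * t * e = e * (t * t)
    rw [mul_assoc, hte, ← mul_assoc, htf, mul_assoc]
  have hmf : m * f = f * m := by
    refine Commute.cfc_real ?_ _
    show t * t * f = f * (t * t)
    rw [mul_assoc, htf, ← mul_assoc, hte, mul_assoc]
  obtain ⟨P, hP, h1, h2⟩ := ann_exists hAW {tp}
  have h1 : tp * P = tp := h1 _ rfl
  have h2 : ∀ x, tp * x = 0 → P * x = 0 := fun x hx => h2 x (by rintro _ rfl; exact hx)
  obtain ⟨N, hN, k1, k2⟩ := ann_exists hAW {tn}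
  have k1 : tn * N = tn := k1 _ rfl
  have k2 : ∀ x, tn * x = 0 → N * x = 0 := fun x hx => k2 x (by rintro _ rfl; exact hx)
  have hPp : P * tp = tp := by simpa [hP.1, hpsa] using congrArg star h1
  have hNn : N * tn = tn := by simpa [hN.1, hnsa] using congrArg star k1
  have hPn : P * tn = 0 := h2 _ hpn
  have hnP : tn * P = 0 := by simpa [hP.1, hnsa] using congrArg star hPn
  have hNP : N * P = 0 := k2 _ hnP
  have hPN : P * N = 0 := orth_symm hN hP hNP
  have hnp : tn * tp = 0 := by simpa [hpsa, hnsa] using congrArg star hpn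
  have hNp : N * tp = 0 := k2 _ hnp
  have hpN : tp * N = 0 := by simpa [hN.1, hpsa] using congrArg star hNp
  set s := P + N with hs
  set u := P - N with hu
  have hsp : IsProjection s := proj_add hP hN hPN
  have hus : star u = u := by simp [hu, hP.1, hN.1]
  have huu : u * u = s := by simp [hu, hs, mul_sub, sub_mul, hP.2, hN.2, hPN, hNP]
  have hum : u * m = t := by
    rw [hu, hmt, htt]; simp only [mul_add, sub_mul, hPp, hPn, hNp, hNn]; abel
  have hussu : u * s = u := by simp only [hu, hs, mul_add, sub_mul, hP.2, hN.2, hPN, hNP]; abel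
  have hms : m * s = m := by
    rw [hs, hmt]; simp [mul_add, add_mul, h1, k1, hnP, hpN]; 
  have hann : ∀ x, m * x = 0 → s * x = 0 := by
    intro x hx
    have e1 : tp * x = 0 := by
      have : P * (m * x) = 0 := by rw [hx, mul_zero]
      rwa [← mul_assoc, hmt, mul_add, hPp, hPn, add_zero] at this
    have e2 : tn * x = 0 := by
      have : N * (m * x) = 0 := by rw [hx, mul_zero]
      rwa [← mul_assoc, hmt, mul_add, hNp, hNn, zero_add] at this
    rw [hs, add_mul, h2 x e1, k2 x e2, add_zero]
  have hcomm : ∀ g, IsProjection g → m * g = g * m → s * g = g * s := by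
    intro g hg hmg
    have : s * (g * (1 - s)) = 0 := hann _ (by
      rw [← mul_assoc, hmg, mul_assoc, mul_sub, hms]; simp)
    have e1 : s * g = s * g * s := by
      rw [← sub_eq_zero, ← this]; noncomm_ring
    have e2 := congrArg star e1
    simp only [star_mul, hg.1, hsp.1] at e2
    rw [e1, e2, mul_assoc]
  have hse := hcomm e he hme
  have hsf := hcomm f hf hmf
  have hmsa : star m = m := by rw [hmt]; simp [hpsa, hnsa]
  have hue : u * e = f * u := by
    have h0 : (u * e - f * u) * m = 0 := by
      rw [sub_mul, mul_assoc, ← hme, ← mul_assoc, hum, mul_assoc, hum, hte, sub_self]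
    have h3 : s * star (u * e - f * u) = 0 := hann _ (by
      have := congrArg star h0
      rwa [star_mul, hmsa, star_zero] at this)
    have h4 : (u * e - f * u) * s = 0 := by
      have := congrArg star h3
      rwa [star_mul, hsp.1, star_star, star_zero] at this
    rwa [sub_mul, mul_assoc, ← hse, ← mul_assoc, hussu, mul_assoc, hussu, sub_eq_zero] at h4
  have hfin : t * (1 - s) = 0 := by rw [← hum, mul_assoc, mul_sub, hms]; simp
  refine ⟨s, hsp, hse, hsf, ⟨u * e, ?_, ?_⟩, ?_, ?_⟩
  · calc star (u * e) * (u * e) = e * (u * u) * e := by simp [hus, he.1, mul_assoc]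
      _ = e * s := by rw [huu, mul_assoc, hse, ← mul_assoc, he.2]
  · calc u * e * star (u * e) = u * (e * e) * u := by simp [hus, he.1, mul_assoc]
      _ = f * s := by rw [he.2, hue, mul_assoc, huu]
  · have : f * (t * (1 - s)) = 0 := by rw [hfin, mul_zero]
    have h5 : f * t = f * e := by rw [ht, mul_sub, mul_add, hf.2]; simp
    rwa [← mul_assoc, h5, mul_assoc] at this
  · have : e * (t * (1 - s)) = 0 := by rw [hfin, mul_zero]
    have h5 : e * t = e * f := by rw [ht, mul_sub, mul_add, he.2]; simp
    rwa [← mul_assoc, h5, mul_assoc] at this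

end AWS

end Part3

section Part4
namespace AWS

variable {A : Type u} [CStarAlgebra A]

lemma central_sep (hAW : IsAWStarRing A) {r s : A} (h : ∀ c, r * c * s = 0) :
    ∃ z, IsCentralProj z ∧ z * r = r ∧ z * s = 0 := by
  obtain ⟨q, hq, h1, h2⟩ := ann_exists hAW (Set.range fun a => r * a)
  have h1 : ∀ a, r * a * q = r * a := fun a => h1 _ ⟨a, rfl⟩
  have h2 : ∀ x, (∀ a, r * a * x = 0) → q * x = 0 := fun x hx =>
    h2 x (by rintro _ ⟨a, rfl⟩; exact hx a)
  have h3 : ∀ c, q * c = q * c * q := by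
    intro c
    have : q * (c * (1 - q)) = 0 := h2 _ fun a => by
      have := h1 (a * c)
      rw [← sub_eq_zero] at this
      rw [← neg_eq_zero, ← this]; noncomm_ring
    rw [← sub_eq_zero, ← this]; noncomm_ring
  have h4 : ∀ c, q * c = c * q := by
    intro c
    have := congrArg star (h3 (star c))
    simp only [star_mul, hq.1, star_star] at this
    rw [h3 c, this, mul_assoc]
  refine ⟨q, ⟨hq, h4⟩, ?_, h2 s fun a => h a⟩
  have := h1 1
  rw [h4]; simpa using this

lemma zorn_pw {X : Type*} (Q : X → Prop) (R : X → X → Prop) (S0 : Set X) (h0 : ∀ x ∈ S0, Q x)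
    (h0' : S0.Pairwise R) : ∃ S, S0 ⊆ S ∧ (∀ x ∈ S, Q x) ∧ S.Pairwise R ∧
      ∀ x, Q x → (∀ y ∈ S, R x y ∧ R y x) → x ∈ S := by
  obtain ⟨S, hS0, hS⟩ := zorn_subset_nonempty {S : Set X | (∀ x ∈ S, Q x) ∧ S.Pairwise R}
    (by
      intro c hc hch hne
      refine ⟨⋃₀ c, ⟨?_, ?_⟩, fun s hs => Set.subset_sUnion_of_mem hs⟩
      · rintro x ⟨s, hs, hx⟩
        exact (hc hs).1 x hx
      · exact (Set.pairwise_sUnion hch.directedOn).2 fun s hs => (hc hs).2) S0 ⟨h0, h0'⟩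
  refine ⟨S, hS0, hS.prop.1, hS.prop.2, fun x hx hxy => ?_⟩
  have : insert x S ⊆ S := hS.le_of_ge (y := insert x S)
    ⟨by rintro y (rfl | hy); exacts [hx, hS.prop.1 _ hy],
      hS.prop.2.insert fun y hy _ => hxy y hy⟩ (Set.subset_insert _ _)
  exact this (Set.mem_insert _ _)

lemma sub_mul_zero {s e : A} (hs : IsProjection s) (he : IsProjection e) (h : s * e = s) :
    (e - s) * s = 0 := by
  rw [sub_mul, le_symm hs he h, hs.2, sub_self]

lemma gc_orth (hAW : IsAWStarRing A) {e f : A} (he : IsProjection e) (hf : IsProjection f)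
    (hef : e * f = 0) : ∃ z, IsCentralProj z ∧ ProjSubEquiv (z * e) (z * f) ∧
      ProjSubEquiv ((1 - z) * f) ((1 - z) * e) := by
  obtain ⟨S, -, hQ, hR, hmax⟩ := zorn_pw (X := A × A)
    (fun x => IsProjection x.1 ∧ IsProjection x.2 ∧ x.1 * e = x.1 ∧ x.2 * f = x.2 ∧ x.1 ≠ 0 ∧
      ProjEquiv x.1 x.2) (fun x y => x.1 * y.1 = 0 ∧ x.2 * y.2 = 0) ∅ (by simp) (by simp)
  obtain ⟨s, hs⟩ := psum_exists hAW (fun i : S => i.1.1)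
  obtain ⟨t, ht⟩ := psum_exists hAW (fun i : S => i.1.2)
  have hst : ProjEquiv s t := by
    refine add_orth hAW (fun i => (hQ _ i.2).1) (fun i => (hQ _ i.2).2.1)
      (fun i j hij => (hR i.2 j.2 fun h => hij (Subtype.ext h)).1)
      (fun i j hij => (hR i.2 j.2 fun h => hij (Subtype.ext h)).2) ?_
      (fun i => (hQ _ i.2).2.2.2.2.2) hs ht
    intro i j
    rw [← (hQ _ i.2).2.2.1, ← le_symm (hQ _ j.2).2.1 hf (hQ _ j.2).2.2.2.1, mul_assoc,
      ← mul_assoc e, hef]; simp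
  have hse : s * e = s := psum_le hs fun i => (hQ _ i.2).2.2.1
  have htf : t * f = t := psum_le ht fun i => (hQ _ i.2).2.2.2.1
  have hr : IsProjection (e - s) := proj_sub hs.1 he hse
  have hq : IsProjection (f - t) := proj_sub ht.1 hf htf
  have hrs := sub_mul_zero hs.1 he hse
  have hqt := sub_mul_zero ht.1 hf htf
  have key : ∀ c, (f - t) * c * (e - s) = 0 := by
    intro c
    by_contra hc
    obtain ⟨b, a, hb, ha, hbq, har, hb0, hba⟩ := exists_sub_equiv hAW hq hr hc
    have ha0 : a ≠ 0 := by rintro rfl; exact hb0 (eqv_zero hba)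
    have has : a * s = 0 := by rw [← har, mul_assoc, hrs, mul_zero]
    have hbt : b * t = 0 := by rw [← hbq, mul_assoc, hqt, mul_zero]
    have h1 : ∀ y ∈ S, a * y.1 = 0 ∧ b * y.2 = 0 := by
      intro y hy
      refine ⟨?_, ?_⟩
      · rw [← le_symm (hQ _ hy).1 hs.1 (hs.2.1 ⟨y, hy⟩), ← mul_assoc, has, zero_mul]
      · rw [← le_symm (hQ _ hy).2.1 ht.1 (ht.2.1 ⟨y, hy⟩), ← mul_assoc, hbt, zero_mul]
    have hmem := hmax (a, b) ⟨ha, hb, by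
        rw [← har, mul_assoc, sub_mul, he.2, hse], by
        rw [← hbq, mul_assoc, sub_mul, hf.2, htf], ha0, eqv_symm hba⟩
        fun y hy => ⟨h1 y hy, orth_symm ha (hQ _ hy).1 (h1 y hy).1,
          orth_symm hb (hQ _ hy).2.1 (h1 y hy).2⟩
    have := hs.2.1 ⟨_, hmem⟩
    simp only at this
    exact ha0 (by rw [← this, has])
  obtain ⟨z, hz, hz1, hz2⟩ := central_sep hAW key
  have hz' := central_one_sub hz
  have e1 : z * e = z * s := by rwa [mul_sub, sub_eq_zero] at hz2
  have e2 : (1 - z) * f = (1 - z) * t := by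
    rw [← sub_eq_zero, ← mul_sub, sub_mul, hz1]; simp
  refine ⟨z, hz, ?_, ?_⟩
  · rw [e1]
    exact sub_cut hz ⟨t, ht.1, htf, hst⟩
  · rw [e2]
    exact sub_cut hz' ⟨s, hs.1, hse, eqv_symm hst⟩

lemma gc (hAW : IsAWStarRing A) {e f : A} (he : IsProjection e) (hf : IsProjection f) :
    ∃ z, IsCentralProj z ∧ ProjSubEquiv (z * e) (z * f) ∧
      ProjSubEquiv ((1 - z) * f) ((1 - z) * e) := by
  obtain ⟨s, hs, hse, hsf, hE, h1, h2⟩ := position hAW he hf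
  have pe : IsProjection (e * s) := ⟨by simp [he.1, hs.1, hse], by
    rw [mul_assoc, ← mul_assoc s, hse, mul_assoc, hs.2, ← mul_assoc, he.2]⟩
  have pf : IsProjection (f * s) := ⟨by simp [hf.1, hs.1, hsf], by
    rw [mul_assoc, ← mul_assoc s, hsf, mul_assoc, hs.2, ← mul_assoc, hf.2]⟩
  have pe' : IsProjection (e * (1 - s)) := by
    rw [mul_sub, mul_one]
    exact proj_sub pe he (by rw [mul_assoc, hse, ← mul_assoc, he.2])
  have pf' : IsProjection (f * (1 - s)) := by
    rw [mul_sub, mul_one]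
    exact proj_sub pf hf (by rw [mul_assoc, hsf, ← mul_assoc, hf.2])
  have oe : e * s * (e * (1 - s)) = 0 := by
    rw [mul_assoc, ← mul_assoc s, hse, mul_assoc, mul_sub, hs.2]; simp
  have of : f * s * (f * (1 - s)) = 0 := by
    rw [mul_assoc, ← mul_assoc s, hsf, mul_assoc, mul_sub, hs.2]; simp
  obtain ⟨z, hz, k1, k2⟩ := gc_orth hAW pe' pf' (by
    have : (1 - s) * f = f * (1 - s) := by rw [sub_mul, mul_sub, hsf]; simp
    rw [mul_assoc, ← mul_assoc _ f, this, ← mul_assoc, ← mul_assoc, mul_assoc e, h2, zero_mul])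
  have hz' := central_one_sub hz
  have co : ∀ {w a b : A}, IsCentralProj w → a * b = 0 → w * a * (w * b) = 0 := by
    intro w a b hw h
    rw [hw.2 b, ← mul_assoc, mul_assoc w, h]; simp
  have ee : e * s + e * (1 - s) = e := by rw [mul_sub]; simp
  have ff : f * s + f * (1 - s) = f := by rw [mul_sub]; simp
  refine ⟨z, hz, ?_, ?_⟩
  · have := sub_add (cproj_mul hz pe) (cproj_mul hz pe') (cproj_mul hz pf) (cproj_mul hz pf')
      (co hz oe) (co hz of) (sub_cut hz (sub_of_eqv pe hE)) k1
    rwa [← mul_add z, ← mul_add z, ee, ff] at this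
  · have := sub_add (cproj_mul hz' pf) (cproj_mul hz' pf') (cproj_mul hz' pe) (cproj_mul hz' pe')
      (co hz' of) (co hz' oe) (sub_cut hz' (sub_of_eqv pf (eqv_symm hE))) k2
    rwa [← mul_add (1 - z), ← mul_add (1 - z), ee, ff] at this

lemma cut_orth {w a b : A} (hw : IsCentralProj w) (h : a * b = 0) : w * a * (w * b) = 0 := by
  rw [hw.2 b, ← mul_assoc, mul_assoc w, h]; simp

lemma psum_cut {ι : Type*} {p : ι → A} {s z : A} (hz : IsCentralProj z) (hs : PSum p s) :
    PSum (fun i => z * p i) (z * s) := by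
  refine ⟨cproj_mul hz hs.1, fun i => ?_, fun x hx => ?_⟩
  · rw [hz.2 s, ← mul_assoc, mul_assoc z, hs.2.1, mul_assoc, ← hz.2, ← mul_assoc, hz.1.2]
  · rw [hz.2, mul_assoc]
    exact hs.2.2 _ fun i => by rw [← mul_assoc, ← hz.2]; exact hx i

lemma psum_equiv {ι κ : Type*} {p : ι → A} {s : A} (φ : κ ≃ ι) (hs : PSum p s) :
    PSum (fun k => p (φ k)) s :=
  ⟨hs.1, fun k => hs.2.1 _, fun x hx => hs.2.2 x fun i => by simpa using hx (φ.symm i)⟩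

lemma psum_orth {ι κ : Type*} {p : ι → A} {q : κ → A} {s t : A} (hq : ∀ i, IsProjection (q i))
    (hs : PSum p s) (ht : PSum q t) (h : ∀ i j, p i * q j = 0) : s * t = 0 :=
  hs.2.2 _ fun i => psum_left hq ht (h i)

lemma psum_sum {ι κ : Type*} {p : ι → A} {q : κ → A} {s t : A} (hp : ∀ i, IsProjection (p i))
    (hq : ∀ i, IsProjection (q i))
    (hs : PSum p s) (ht : PSum q t) (h : ∀ i j, p i * q j = 0) : PSum (Sum.elim p q) (s + t) := by
  have o := psum_orth hq hs ht h
  have o' := psum_orth hp ht hs fun j i => orth_symm (hp i) (hq j) (h i j)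
  refine ⟨proj_add hs.1 ht.1 o, ?_, ?_⟩
  · rintro (i | j)
    · simp only [Sum.elim_inl, mul_add]
      rw [hs.2.1, ← hs.2.1 i, mul_assoc, o]; simp
    · simp only [Sum.elim_inr, mul_add]
      rw [ht.2.1, ← ht.2.1 j, mul_assoc, o']; simp
  · intro x hx
    rw [add_mul, hs.2.2 x fun i => hx (Sum.inl i), ht.2.2 x fun i => hx (Sum.inr i), add_zero]

/-- associativity -/
lemma psum_psum {ι κ : Type*} {p : ι × κ → A} {q : ι → A} {s : A}
    (hs : PSum p s) (hq : ∀ i, PSum (fun k => p (i, k)) (q i)) : PSum q s :=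
  ⟨hs.1, fun i => psum_le (hq i) fun k => hs.2.1 _, fun x hx => hs.2.2 x fun ⟨i, k⟩ => by
    have h := (hq i).2.1 k
    simp only at h
    rw [← h, mul_assoc, hx, mul_zero]⟩

/-- orthogonal families of pairwise equivalent projections -/
def Homog {ι : Type*} (p : ι → A) : Prop :=
  (∀ i, IsProjection (p i)) ∧ PairwiseOrthogonal p ∧ ∀ i j, ProjEquiv (p i) (p j)

lemma split (hAW : IsAWStarRing A) {ι : Type*} [Infinite ι] {p : ι → A} (hp : Homog p) {G : A}
    (hG : PSum p G) : ∃ a b : ι → A, Homog a ∧ Homog b ∧ (∀ i j, a i * b j = 0) ∧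
      (∀ i j, ProjEquiv (a i) (b j)) ∧ (∀ i j, ProjEquiv (a i) (p j)) ∧
      ∃ s t, PSum a s ∧ PSum b t ∧ s * t = 0 ∧ G = s + t ∧ ProjEquiv s t := by
  obtain ⟨φ⟩ : Nonempty (ι ⊕ ι ≃ ι) := by
    rw [← Cardinal.eq, Cardinal.mk_sum]
    simp [Cardinal.add_mk_eq_self]
  obtain ⟨s, hs⟩ := psum_exists hAW fun i => p (φ (.inl i))
  obtain ⟨t, ht⟩ := psum_exists hAW fun i => p (φ (.inr i))
  have hab : ∀ i j, p (φ (.inl i)) * p (φ (.inr j)) = 0 := fun i j => hp.2.1 _ _ (by simp)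
  have ha : PairwiseOrthogonal fun i => p (φ (.inl i)) := fun i j hij => hp.2.1 _ _ (by simpa)
  have hb : PairwiseOrthogonal fun i => p (φ (.inr i)) := fun i j hij => hp.2.1 _ _ (by simpa)
  refine ⟨fun i => p (φ (.inl i)), fun i => p (φ (.inr i)), ⟨fun i => hp.1 _, ha, fun i j => hp.2.2 _ _⟩,
    ⟨fun i => hp.1 _, hb, fun i j => hp.2.2 _ _⟩, hab, fun i j => hp.2.2 _ _, fun i j => hp.2.2 _ _,
    s, t, hs, ht, psum_orth (fun _ => hp.1 _) hs ht hab, ?_,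
    add_orth hAW (fun _ => hp.1 _) (fun _ => hp.1 _) ha hb hab (fun i => hp.2.2 _ _) hs ht⟩
  refine psum_unique (psum_equiv φ hG) ?_
  convert psum_sum (fun i => hp.1 (φ (.inl i))) (fun i => hp.1 (φ (.inr i))) hs ht hab using 1
  ext (i | i) <;> rfl

lemma half (hAW : IsAWStarRing A) {ι : Type*} [Infinite ι] {p : ι → A} (hp : Homog p) {G : A}
    (hG : PSum p G) : ∃ a b : ι → A, Homog a ∧ Homog b ∧ (∀ i j, a i * b j = 0) ∧
      (∀ i j, ProjEquiv (a i) (b j)) ∧ (∀ i j, ProjEquiv (a i) (p j)) ∧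
      ∃ s t, PSum a s ∧ PSum b t ∧ s * t = 0 ∧ G = s + t ∧ ProjEquiv s t ∧ ProjEquiv G s := by
  obtain ⟨a, b, ha, hb, hab, habe, hap, s, t, hs, ht, hst, hG', hE⟩ := split hAW hp hG
  refine ⟨a, b, ha, hb, hab, habe, hap, s, t, hs, ht, hst, hG', hE, ?_⟩
  obtain ⟨c, d, hc, hd, hcd, hcde, hca, s1, s2, hs1, hs2, hss, hs', hE'⟩ := split hAW ha hs
  have cle : ∀ i, c i * s = c i := fun i => by
    have := hs1.2.1 i
    have h2 : s1 * s = s1 := by rw [hs', mul_add, hs1.1.2, hss, add_zero]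
    rw [← this, mul_assoc, h2]
  have tc : ProjEquiv s1 t := by
    refine add_orth hAW hc.1 hb.1 hc.2.1 hb.2.1 (fun i j => ?_)
      (fun i => eqv_trans (hc.1 i) (hca i i) (habe i i)) hs1 ht
    rw [← cle, ← le_symm (hb.1 j) ht.1 (ht.2.1 j), mul_assoc, ← mul_assoc s, hst]; simp
  have e1 : ProjEquiv s s1 := eqv_trans hs.1 hE (eqv_symm tc)
  have e2 : ProjEquiv t s2 := eqv_trans ht.1 (eqv_symm tc) hE'
  have := eqv_add hs.1 ht.1 hst hss e1 e2
  rwa [← hG', ← hs'] at this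

lemma gamma_transport (hAW : IsAWStarRing A) {e f : A} (he : IsProjection e) (h : ProjEquiv e f)
    {ι : Type u} {p : ι → A} (hp : InGamma e p) : ∃ q : ι → A, InGamma f q := by
  obtain ⟨v, h1, h2, h3, h4, h5, h6, hf⟩ := eqv_data he h
  have hs := isSup_psum hAW hp.2.2.2
  have ht := fun i => transport he h1 h2 (hp.1 i) (hs.2.1 i)
  refine ⟨fun i => v * p i * star v, fun i => (ht i).1, fun i j hij => ?_, fun i => ?_, ?_⟩
  · calc v * p i * star v * (v * p j * star v) = v * (p i * (star v * v)) * p j * star v := by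
          noncomm_ring
      _ = v * (p i * p j) * star v := by rw [h1, hs.2.1]; noncomm_ring
      _ = 0 := by rw [hp.2.1 i j hij]; simp
  · exact eqv_trans (ht i).1 (eqv_symm (ht i).2.2) (eqv_trans (hp.1 i) (hp.2.2.1 i) h)
  · have := psum_transport hp.1 he h1 h2 hs he.2
    rw [h3, h2] at this
    exact psum_isSup this

lemma gamma_of_family (hAW : IsAWStarRing A) {ι : Type u} [Infinite ι] {p : ι → A} (hp : Homog p)
    {G : A} (hG : PSum p G) : ∃ q : ι → A, InGamma G q := by
  obtain ⟨a, b, ha, hb, hab, habe, hap, s, t, hs, ht, hst, hG', hE, hGs⟩ := half hAW hp hG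
  obtain ⟨φ⟩ : Nonempty (ι × ι ≃ ι) := by
    rw [← Cardinal.eq, Cardinal.mk_prod]
    exact (by simpa using Cardinal.mul_eq_self (Cardinal.aleph0_le_mk ι))
  choose q hq using fun i => psum_exists hAW fun k => b (φ (i, k))
  have hqs : ∀ i, ProjEquiv s (q i) := fun i =>
    add_orth hAW ha.1 (fun _ => hb.1 _) ha.2.1 (fun k l hkl => hb.2.1 _ _ (by simpa)) (fun _ _ => hab _ _)
      (fun _ => habe _ _) hs (hq i)
  have hqt : PSum q t := psum_psum (psum_equiv φ ht) hq
  have : InGamma t q := by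
    refine ⟨fun i => (hq i).1, fun i j hij => ?_, fun i => ?_, psum_isSup hqt⟩
    · exact psum_orth (fun _ => hb.1 _) (hq i) (hq j) fun k l => hb.2.1 _ _ (by simp [hij])
    · exact eqv_trans (hq i).1 (eqv_symm (hqs i)) hE
  exact gamma_transport hAW ht.1 (eqv_symm (eqv_trans hG.1 hGs hE)) this

end AWS

end Part4

section Part5
namespace AWS

variable {A : Type u} [CStarAlgebra A]

lemma ne_of_eqv {e f : A} (h : ProjEquiv e f) (he : e ≠ 0) : f ≠ 0 := by
  rintro rfl; exact he (eqv_zero h)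

lemma inj_of_orth {ι : Type*} {p : ι → A} (hp : ∀ i, IsProjection (p i))
    (ho : PairwiseOrthogonal p) (h0 : ∀ i, p i ≠ 0) : Function.Injective p := by
  intro i j hij
  by_contra hne
  apply h0 i
  rw [← (hp i).2]
  nth_rewrite 2 [hij]
  exact ho i j hne

lemma L1 (hAW : IsAWStarRing A) {f g : A} (hf : IsProjection f) (hg : IsProjection g) (hg0 : g ≠ 0)
    {ι : Type u} [Infinite ι] {p : ι → A} (hp : ∀ i, IsProjection (p i))
    (ho : PairwiseOrthogonal p) (hpf : ∀ i, p i * f = p i) (hpg : ∀ i, ProjEquiv g (p i)) :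
    ∃ z, IsCentralProj z ∧ z * g ≠ 0 ∧ ∃ (κ : Type u) (_ : Infinite κ) (q : κ → A),
      Cardinal.mk ι ≤ Cardinal.mk κ ∧ Homog q ∧ (∀ i, ProjEquiv (z * g) (q i)) ∧
      (∃ G, PSum q G ∧ ProjEquiv (z * f) G) ∧ ∃ r : κ → A, InGamma (z * f) r := by
  have hinj := inj_of_orth hp ho fun i => ne_of_eqv (hpg i) hg0
  obtain ⟨S, hS0, hQ, hR, hmax⟩ := zorn_pw (X := A)
    (fun x => IsProjection x ∧ x * f = x ∧ ProjEquiv g x) (fun x y => x * y = 0) (Set.range p)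
    (by rintro _ ⟨i, rfl⟩; exact ⟨hp i, hpf i, hpg i⟩)
    (by rintro _ ⟨i, rfl⟩ _ ⟨j, rfl⟩ hne; exact ho i j fun h => hne (by rw [h]))
  have hcard : Cardinal.mk ι ≤ Cardinal.mk S :=
    Cardinal.mk_le_of_injective (f := fun i => (⟨p i, hS0 ⟨i, rfl⟩⟩ : S))
      fun i j h => hinj (congrArg Subtype.val h)
  have hinf : Infinite S := by
    rw [Cardinal.infinite_iff]; exact (Cardinal.aleph0_le_mk ι).trans hcard
  let i0 : ι := Classical.arbitrary ι
  set j0 : S := ⟨p i0, hS0 ⟨i0, rfl⟩⟩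
  obtain ⟨G, hG⟩ := psum_exists hAW (fun i : S => i.1)
  have hGf : G * f = G := psum_le hG fun i => (hQ _ i.2).2.1
  have hr := proj_sub hG.1 hf hGf
  have hrG := sub_mul_zero hG.1 hf hGf
  have hxo : ∀ x, x * (f - G) = x → x * G = 0 ∧ ∀ y ∈ S, x * y = 0 := by
    intro x hx
    have h1 : x * G = 0 := by rw [← hx, mul_assoc, hrG, mul_zero]
    refine ⟨h1, fun y hy => ?_⟩
    rw [← le_symm (hQ _ hy).1 hG.1 (hG.2.1 ⟨y, hy⟩), ← mul_assoc, h1, zero_mul]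
  obtain ⟨z, hz, k1, k2⟩ := gc_orth hAW hr (hp i0) ((hxo _ hr.2).2 _ j0.2)
  have hzg0 : z * p i0 ≠ 0 := by
    intro h0
    have : (1 - z) * p i0 = p i0 := by rw [sub_mul, h0]; simp
    rw [this] at k2
    obtain ⟨x, hx, hxr, hxe⟩ := k2
    have hxr' : x * (f - G) = x := by
      have hxr : x * ((1 - z) * (f - G)) = x := hxr
      have := (central_one_sub hz).2 (f - G)
      rw [this] at hxr
      nth_rewrite 1 [← hxr]
      rw [mul_assoc, mul_assoc, (central_one_sub hz).2 (f - G), ← mul_assoc (f - G), hr.2, hxr]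
    have hgx : ProjEquiv g x := eqv_trans hg (hpg i0) hxe
    have hmem := hmax x ⟨hx, by
      have : (f - G) * f = f - G := by rw [sub_mul, hf.2, hGf]
      nth_rewrite 1 [← hxr']
      rw [mul_assoc, this, hxr'], hgx⟩
      fun y hy => ⟨(hxo x hxr').2 y hy, orth_symm hx (hQ _ hy).1 ((hxo x hxr').2 y hy)⟩
    have := hG.2.1 ⟨x, hmem⟩
    simp only [(hxo x hxr').1] at this
    exact ne_of_eqv hgx hg0 this.symm
  have hzg : z * g ≠ 0 := ne_of_eqv (eqv_symm (eqv_cut hz (hpg i0))) hzg0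
  have hH : Homog fun i : S => z * i.1 :=
    ⟨fun i => cproj_mul hz (hQ _ i.2).1, fun i j hij =>
      cut_orth hz (hR i.2 j.2 fun h => hij (Subtype.ext h)), fun i j => eqv_cut hz
      (eqv_trans (hQ _ i.2).1 (eqv_symm (hQ _ i.2).2.2) (hQ _ j.2).2.2)⟩
  have hzG := psum_cut hz hG
  have hE : ProjEquiv (z * f) (z * G) := by
    obtain ⟨a, b, ha, hb, hab, habe, hap, s, t, hs, ht, hst, hG', hE, hGs⟩ := half hAW hH hzG
    refine sb_le hAW (cproj_mul hz hf) hzG.1 ?_ ?_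
    · rw [hz.2 f, ← mul_assoc, mul_assoc z, hGf, mul_assoc, ← hz.2, ← mul_assoc, hz.1.2]
    · have e1 : z * f = z * G + z * (f - G) := by rw [mul_sub]; abel
      have e2 : ProjSubEquiv (z * (f - G)) t := by
        refine sub_trans (cproj_mul hz hr) (cproj_mul hz (hp i0)) ht.1 k1 ?_
        refine ⟨b j0, hb.1 _, ht.2.1 _, ?_⟩
        exact eqv_trans (cproj_mul hz (hp i0)) (eqv_symm (hap j0 j0)) (habe _ _)
      have := sub_add hzG.1 (cproj_mul hz hr) hs.1 ht.1
        (cut_orth hz (orth_symm hr hG.1 hrG)) hst (sub_of_eqv hzG.1 hGs) e2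
      rw [e1, hG']
      rwa [← hG'] at this ⊢
  obtain ⟨r, hr⟩ := gamma_of_family hAW hH hzG
  exact ⟨z, hz, hzg, S, hinf, fun i => z * i.1, hcard, hH, fun i => eqv_cut hz (hQ _ i.2).2.2,
    ⟨_, hzG, hE⟩, gamma_transport hAW hzG.1 (eqv_symm hE) hr⟩

lemma inf_gamma (hAW : IsAWStarRing A) {f : A} (hf : IsProjection f) (h : ¬ ProjFinite f) :
    ∃ z, IsCentralProj z ∧ z * f ≠ 0 ∧ ∃ (κ : Type u) (_ : Infinite κ) (r : κ → A),
      InGamma (z * f) r := by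
  unfold ProjFinite at h
  push Not at h
  obtain ⟨f', hf', hE, hle, hne⟩ := h
  have hle : f' * f = f' := hle
  obtain ⟨v, h1, h2, h3, h4, h5, h6, -⟩ := eqv_data hf hE
  have hff := le_symm hf' hf hle
  have hfv : f * v = v := by rw [← h4, ← mul_assoc, hff]
  have hD := proj_sub hf' hf hle
  obtain ⟨p, -, -, hp, hpf, ho, hpe⟩ := shift_seq (v := v) hf h1 hfv hD
    (by rw [sub_mul, hf.2, hle]) (by rw [sub_mul, hfv, h4, sub_self])
  obtain ⟨z, hz, hzg, κ, hκ, q, -, -, -, -, r, hr⟩ := L1 hAW (ι := ULift.{u} ℕ) hf hD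
    (fun h => hne (sub_eq_zero.1 h).symm) (p := fun i => p i.down) (fun i => hp _)
    (fun i j hij => ho _ _ fun h => hij (ULift.ext _ _ h)) (fun i => hpf _) (fun i => hpe _)
  refine ⟨z, hz, fun h0 => hzg ?_, κ, hκ, r, hr⟩
  have : (f - f') = f * (f - f') := by rw [mul_sub, hf.2, hff]
  rw [this, ← mul_assoc, h0, zero_mul]

lemma lt_dim {e : A} (he : e ≠ 0) {ι : Type u} {p : ι → A} (hp : InGamma e p) :
    Cardinal.mk ι < projDim e := by
  rw [projDim, if_neg he, ← Order.succ_le_iff]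
  refine le_csSup ⟨Order.succ (Cardinal.mk A), ?_⟩ ⟨ι, p, hp, rfl⟩
  rintro c ⟨κ, q, hq, rfl⟩
  refine Order.succ_le_succ (Cardinal.mk_le_of_injective (f := q) ?_)
  exact inj_of_orth hq.1 hq.2.1 fun i => ne_of_eqv (eqv_symm (hq.2.2.1 i)) he

lemma exists_gamma {e : A} {c : Cardinal.{u}} (hc : c < projDim e) :
    ∃ (ι : Type u) (p : ι → A), InGamma e p ∧ c ≤ Cardinal.mk ι := by
  rw [projDim] at hc
  split_ifs at hc with he
  · exact absurd hc (not_lt_of_ge (zero_le))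
  · obtain ⟨d, ⟨ι, p, hp, rfl⟩, hd⟩ := exists_lt_of_lt_csSup' hc
    exact ⟨ι, p, hp, Order.lt_succ_iff.1 hd⟩

lemma dim_le {e : A} {d : Cardinal.{u}}
    (h : ∀ (ι : Type u) (p : ι → A), InGamma e p → Cardinal.mk ι < d) : projDim e ≤ d := by
  rw [projDim]
  split_ifs with he
  · exact zero_le
  · refine csSup_le' ?_
    rintro c ⟨κ, q, hq, rfl⟩
    exact Order.succ_le_of_lt (h κ q hq)

lemma dim_mono (hAW : IsAWStarRing A) {e f : A} (he : IsProjection e) (he0 : e ≠ 0)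
    (hf : Equidimensional f) (h : ProjSubEquiv e f) : projDim e ≤ projDim f := by
  refine dim_le fun ι p hp => ?_
  obtain ⟨e', he', hle, hE⟩ := h
  have hfp := hf.1.1
  have hle : e' * f = e' := hle
  rcases finite_or_infinite ι with hι | hι
  · obtain ⟨z, hz, hz0, κ, hκ, r, hr⟩ := inf_gamma hAW hfp
      (by simpa using hf.1.2.2 1 central_one (by simpa using hf.1.2.1))
    rw [← hf.2 z hz hz0]
    exact (Cardinal.mk_lt_aleph0.trans_le (Cardinal.aleph0_le_mk κ)).trans (lt_dim hz0 hr)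
  · obtain ⟨q, hq⟩ := gamma_transport hAW he hE hp
    obtain ⟨z, hz, hz0, κ, hκ, -, hc, -, -, -, r, hr⟩ := L1 hAW hfp he' (ne_of_eqv hE he0) hq.1
      hq.2.1 (fun i => by
        have : q i * e' = q i := hq.2.2.2.2.1 i
        rw [← this, mul_assoc, hle]) (fun i => eqv_symm (hq.2.2.1 i))
    have hzf : z * f ≠ 0 := fun h0 => hz0 (by
      rw [← le_symm he' hfp hle, ← mul_assoc, h0, zero_mul])
    rw [← hf.2 z hz hzf]
    exact hc.trans_lt (lt_dim hzf hr)

lemma sub_zero' {e f : A} (h : ProjSubEquiv e f) (he : e ≠ 0) : f ≠ 0 := by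
  rintro rfl
  obtain ⟨e', -, hl, hE⟩ := h
  have hl : e' * 0 = e' := hl
  rw [mul_zero] at hl
  exact ne_of_eqv hE he hl.symm

lemma local_sub (hAW : IsAWStarRing A) {e f : A} (he : Equidimensional e) (hf : Equidimensional f)
    (hc : ∀ z, IsCentralProj z → z * e ≠ 0 → z * f ≠ 0) (hd : projDim e ≤ projDim f)
    {y : A} (hy : IsCentralProj y) (hy0 : y * e ≠ 0) :
    ∃ z, IsCentralProj z ∧ z * y = z ∧ z * e ≠ 0 ∧ ProjSubEquiv (z * e) (z * f) := by
  have pe := he.1.1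
  have pf := hf.1.1
  obtain ⟨x, hx, k1, k2⟩ := gc hAW pe pf
  by_cases hxy : y * x * e = 0
  swap
  · refine ⟨y * x, central_mul hy hx, ?_, hxy, ?_⟩
    · rw [mul_assoc, hx.2, ← mul_assoc, hy.1.2]
    · rw [mul_assoc, mul_assoc]; exact sub_cut hy k1
  set w := y * (1 - x) with hw
  have hwc : IsCentralProj w := central_mul hy (central_one_sub hx)
  have hwe : w * e = y * e := by rw [hw, mul_sub, sub_mul, hxy]; simp
  have hwy : w * y = w := by rw [hw, mul_assoc, ← hy.2, ← mul_assoc, hy.1.2]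
  have hwf : w * f ≠ 0 := hc w hwc (by rwa [hwe])
  have k3 : ProjSubEquiv (w * f) (w * e) := by
    rw [hw, mul_assoc, mul_assoc]; exact sub_cut hy k2
  obtain ⟨z1, hz1, hz10, κ, hκ, r, hr⟩ := inf_gamma hAW (cproj_mul hwc pf) (hf.1.2.2 w hwc hwf)
  have hgp := cproj_mul hz1 (cproj_mul hwc pf)
  obtain ⟨e', he', hle, hE⟩ := sub_cut hz1 k3
  have hle : e' * (z1 * (w * e)) = e' := hle
  obtain ⟨q0, hq0⟩ := gamma_transport hAW hgp hE hr
  obtain ⟨z2, hz2, hz20, ι, hι, p, -, hp, hpe, ⟨G, hG, hGE⟩, r', hr'⟩ :=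
    L1 hAW (cproj_mul hz1 (cproj_mul hwc pe)) hgp hz10 hq0.1 hq0.2.1 (fun i => by
        have : q0 i * e' = q0 i := hq0.2.2.2.2.1 i
        rw [← this, mul_assoc, hle])
      (fun i => eqv_trans hgp hE (eqv_symm (hq0.2.2.1 i)))
  have k4 := sub_cut hz2 (sub_cut hz1 k3)
  set z := z2 * z1 * w with hz
  have hzc : IsCentralProj z := central_mul (central_mul hz2 hz1) hwc
  have ae : z2 * (z1 * (w * e)) = z * e := by rw [hz]; noncomm_ring
  have af : z2 * (z1 * (w * f)) = z * f := by rw [hz]; noncomm_ring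
  rw [ae, af] at k4
  rw [af] at hpe hz20
  rw [ae] at hGE hr'
  have hze : z * e ≠ 0 := sub_zero' k4 hz20
  have pzf := cproj_mul hzc pf
  have pze := cproj_mul hzc pe
  refine ⟨z, hzc, by rw [hz, mul_assoc, hwy], hze, ?_⟩
  have hcard : Cardinal.mk ι < projDim (z * f) := by
    rw [hf.2 z hzc hz20]
    refine lt_of_lt_of_le ?_ hd
    rw [← he.2 z hzc hze]
    exact lt_dim hze hr'
  obtain ⟨κ', k, hk, hιk⟩ := exists_gamma hcard
  obtain ⟨⟨inj, hinj⟩⟩ := hιk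
  obtain ⟨a, b, ha, hb, hab, habe, hap, s, t, hs, ht, hst, hG', hE', hGs⟩ := half hAW hp hG
  let i0 : ι := Classical.arbitrary ι
  have hb0 : ProjEquiv (z * f) (b i0) :=
    eqv_trans pzf (hpe i0) (eqv_trans (hp.1 i0) (eqv_symm (hap i0 i0)) (habe _ _))
  obtain ⟨k', hk'⟩ := gamma_transport hAW pzf hb0 hk
  have hk'l : ∀ i, k' i * b i0 = k' i := hk'.2.2.2.2.1
  obtain ⟨m, hm⟩ := psum_exists hAW fun i => k' (inj i)
  have hsm : ProjEquiv s m := by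
    refine add_orth hAW ha.1 (fun _ => hk'.1 _) ha.2.1
      (fun i j hij => hk'.2.1 _ _ fun h => hij (hinj h)) (fun i j => ?_)
      (fun i => eqv_trans (ha.1 i) (habe i i0) (eqv_symm (hk'.2.2.1 _))) hs hm
    rw [← le_symm (hk'.1 (inj j)) (hb.1 i0) (hk'l _), ← mul_assoc, hab, zero_mul]
  refine sub_trans pze (hb.1 i0) pzf ⟨m, hm.1, psum_le hm fun i => hk'l _,
    eqv_trans pze hGE (eqv_trans hG.1 hGs hsm)⟩ (sub_of_eqv (hb.1 i0) (eqv_symm hb0))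

end AWS

end Part5

section Part6
namespace AWS

variable {A : Type u} [CStarAlgebra A]

lemma psum_central {ι : Type*} {z : ι → A} {s : A} (hz : ∀ i, IsCentralProj (z i))
    (hs : PSum z s) : IsCentralProj s := by
  have h3 : ∀ c, s * c = s * c * s := by
    intro c
    have : s * (c * (1 - s)) = 0 := hs.2.2 _ fun i => by
      rw [← mul_assoc, (hz i).2, mul_assoc, mul_sub, hs.2.1]; simp
    rw [← sub_eq_zero, ← this]; noncomm_ring
  refine ⟨hs.1, fun c => ?_⟩
  have := congrArg star (h3 (star c))
  simp only [star_mul, hs.1.1, star_star] at this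
  rw [h3 c, this, mul_assoc]

lemma exhaust (hAW : IsAWStarRing A) {e : A} (P : A → Prop)
    (h : ∀ y, IsCentralProj y → y * e ≠ 0 → ∃ z, IsCentralProj z ∧ z * y = z ∧ z * e ≠ 0 ∧ P z) :
    ∃ (S : Set A), (∀ i : S, IsCentralProj i.1 ∧ P i.1) ∧ (∀ i j : S, i ≠ j → i.1 * j.1 = 0) ∧
      ∀ x, IsProjection x → x * e = x → PSum (fun i : S => i.1 * x) x := by
  obtain ⟨S, -, hQ, hR, hmax⟩ := zorn_pw (X := A)
    (fun x => IsCentralProj x ∧ P x) (fun x y => x * y = 0) ∅ (by simp) (by simp)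
  obtain ⟨s, hs⟩ := psum_exists hAW (fun i : S => i.1)
  have hsc := psum_central (fun i : S => (hQ _ i.2).1) hs
  have hse : s * e = e := by
    by_contra hne
    obtain ⟨z, hz, hzy, hz0, hPz⟩ := h (1 - s) (central_one_sub hsc) (by
      rw [sub_mul, one_mul]; exact fun h => hne (sub_eq_zero.1 h).symm)
    have hzs : z * s = 0 := by
      rw [← hzy, mul_assoc, sub_mul, hs.1.2]; simp
    have hmem := hmax z ⟨hz, hPz⟩ fun y hy => by
      have : z * y = 0 := by
        rw [← le_symm (hQ _ hy).1.1 hs.1 (hs.2.1 ⟨y, hy⟩), ← mul_assoc, hzs, zero_mul]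
      exact ⟨this, by rw [← hz.2, this]⟩
    have := hs.2.1 ⟨z, hmem⟩
    simp only [hzs] at this
    exact hz0 (by rw [← this, zero_mul])
  refine ⟨S, fun i => hQ _ i.2, fun i j hij => hR i.2 j.2 fun h => hij (Subtype.ext h), ?_⟩
  intro x hx hxe
  refine ⟨hx, fun i => by rw [mul_assoc, hx.2], fun y hy => ?_⟩
  have h1 := hs.2.2 (x * y) fun i => by rw [← mul_assoc]; exact hy i
  have h2 : x * s = x := by rw [← hxe, mul_assoc, ← hsc.2, hse]
  rwa [← mul_assoc, hsc.2, h2] at h1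

lemma glue {ι : Type*} {w x y : ι → A} {W X Y : A}
    (hx : ∀ i, IsProjection (x i)) (hy : ∀ i, IsProjection (y i)) (ho : PairwiseOrthogonal w)
    (hsum : ∀ i, x i + y i = w i) (hxy : ∀ i, x i * y i = 0) (hW : PSum w W) (hX : PSum x X)
    (hY : PSum y Y) : X * Y = 0 ∧ X + Y = W ∧ PairwiseOrthogonal x ∧ PairwiseOrthogonal y ∧
      ∀ i j, x i * y j = 0 := by
  have hyx := fun i => orth_symm (hx i) (hy i) (hxy i)
  have x1 : ∀ i, x i * w i = x i := fun i => by rw [← hsum, mul_add, (hx i).2, hxy, add_zero]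
  have x2 : ∀ i, w i * x i = x i := fun i => by rw [← hsum, add_mul, (hx i).2, hyx, add_zero]
  have y1 : ∀ i, y i * w i = y i := fun i => by rw [← hsum, mul_add, (hy i).2, hyx, zero_add]
  have y2 : ∀ i, w i * y i = y i := fun i => by rw [← hsum, add_mul, (hy i).2, hxy, zero_add]
  have gen : ∀ i j, i ≠ j → ∀ a b, a * w i = a → w j * b = b → a * b = 0 := by
    intro i j hij a b ha hb
    rw [← ha, ← hb, mul_assoc, ← mul_assoc (w i), ho i j hij]; simp
  have hall : ∀ i j, x i * y j = 0 := by
    intro i j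
    by_cases hij : i = j
    · rw [hij, hxy]
    · exact gen i j hij _ _ (x1 i) (y2 j)
  refine ⟨psum_orth hy hX hY hall, ?_, fun i j hij => gen i j hij _ _ (x1 i) (x2 j),
    fun i j hij => gen i j hij _ _ (y1 i) (y2 j), hall⟩
  refine psum_unique (psum_sum hx hy hX hY hall) ⟨hW.1, ?_, fun c hc => hW.2.2 c fun i => ?_⟩
  · rintro (i | i)
    · simp only [Sum.elim_inl]; rw [← x1, mul_assoc, hW.2.1]
    · simp only [Sum.elim_inr]; rw [← y1, mul_assoc, hW.2.1]
  · have h1 := hc (.inl i)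
    have h2 := hc (.inr i)
    simp only [Sum.elim_inl, Sum.elim_inr] at h1 h2
    rw [← hsum, add_mul, h1, h2, add_zero]

lemma halving (hAW : IsAWStarRing A) {f : A} (hf : ProperlyInfinite f) :
    ∃ a b, IsProjection a ∧ IsProjection b ∧ a * b = 0 ∧ a + b = f ∧ ProjEquiv f a ∧
      ProjEquiv f b := by
  have pf := hf.1
  obtain ⟨S, hS, hSo, hSs⟩ := exhaust hAW (e := f) (fun z => ∃ a b c d, IsProjection a ∧
    IsProjection b ∧ IsProjection c ∧ IsProjection d ∧ a + b = z * f ∧ c + d = a ∧ a * b = 0 ∧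
    c * d = 0 ∧ ProjEquiv a b ∧ ProjEquiv b c ∧ ProjEquiv b d) (by
    intro y hy hy0
    obtain ⟨z, hz, hz0, κ, hκ, r, hr⟩ := inf_gamma hAW (cproj_mul hy pf) (hf.2.2 y hy hy0)
    have hH : Homog r := ⟨hr.1, hr.2.1, fun i j =>
      eqv_trans (hr.1 i) (hr.2.2.1 i) (eqv_symm (hr.2.2.1 j))⟩
    obtain ⟨a, b, ha, -, -, -, -, s, t, hs, ht, hst, hG, hE, -⟩ :=
      half hAW hH (isSup_psum hAW hr.2.2.2)
    obtain ⟨_, _, -, -, -, -, -, s1, s2, hs1, hs2, hss, hG1, hE1, hE2⟩ := half hAW ha hs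
    have e1 : ProjEquiv t s1 := eqv_trans ht.1 (eqv_symm hE) hE2
    refine ⟨z * y, central_mul hz hy, by rw [mul_assoc, hy.1.2], by rwa [mul_assoc], s, t, s1, s2,
      hs.1, ht.1, hs1.1, hs2.1, by rw [← hG, mul_assoc], hG1.symm, hst, hss, hE, e1,
      eqv_trans ht.1 e1 hE1⟩)
  choose hSc a b c d ha hb hc hd hab hcd oab ocd e1 e2 e3 using hS
  obtain ⟨a', sa⟩ := psum_exists hAW a
  obtain ⟨b', sb⟩ := psum_exists hAW b
  obtain ⟨c', sc⟩ := psum_exists hAW c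
  obtain ⟨d', sd⟩ := psum_exists hAW d
  have ho : PairwiseOrthogonal fun i : S => i.1 * f := fun i j hij => by
    show i.1 * f * (j.1 * f) = 0
    rw [(hSc i).2, mul_assoc, ← mul_assoc i.1, hSo i j hij]; simp
  obtain ⟨g1, g2, g3, g4, g5⟩ := glue ha hb ho hab oab (hSs f pf pf.2) sa sb
  obtain ⟨k1, k2, k3, k4, k5⟩ := glue hc hd g3 hcd ocd sa sc sd
  have hAB : ProjEquiv a' b' := add_orth hAW ha hb g3 g4 g5 e1 sa sb
  have g5' : ∀ i j, b i * a j = 0 := fun i j => orth_symm (ha j) (hb i) (g5 j i)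
  have ca : ∀ i, a i * c i = c i := fun i => by
    rw [← hcd, add_mul, (hc i).2, orth_symm (hc i) (hd i) (ocd i), add_zero]
  have da : ∀ i, a i * d i = d i := fun i => by
    rw [← hcd, add_mul, (hd i).2, ocd, zero_add]
  have hBC : ProjEquiv b' c' := add_orth hAW hb hc g4 k3
    (fun i j => by rw [← ca, ← mul_assoc, g5', zero_mul]) e2 sb sc
  have hBD : ProjEquiv b' d' := add_orth hAW hb hd g4 k4
    (fun i j => by rw [← da, ← mul_assoc, g5', zero_mul]) e3 sb sd
  have := eqv_add sa.1 sb.1 g1 k1 (eqv_trans sa.1 hAB hBC) hBD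
  rw [g2, k2] at this
  exact ⟨a', b', sa.1, sb.1, g1, g2, this, eqv_trans pf this hAB⟩

lemma global_sub (hAW : IsAWStarRing A) {e f : A} (he : Equidimensional e) (hf : Equidimensional f)
    (hc : ∀ z, IsCentralProj z → z * e ≠ 0 → z * f ≠ 0) (hd : projDim e ≤ projDim f) :
    ProjSubEquiv e f := by
  have pe := he.1.1
  have pf := hf.1.1
  obtain ⟨S, hS, hSo, hSs⟩ := exhaust hAW (e := e) (fun z => ProjSubEquiv (z * e) (z * f))
    fun y hy hy0 => local_sub hAW he hf hc hd hy hy0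
  obtain ⟨s, hs, hse, hsf, hE, h1, h2⟩ := position hAW pe pf
  have p1 : IsProjection (e * s) := ⟨by simp [pe.1, hs.1, hse], by
    rw [mul_assoc, ← mul_assoc s, hse, mul_assoc, hs.2, ← mul_assoc, pe.2]⟩
  have pfs : IsProjection (f * s) := ⟨by simp [pf.1, hs.1, hsf], by
    rw [mul_assoc, ← mul_assoc s, hsf, mul_assoc, hs.2, ← mul_assoc, pf.2]⟩
  have p2 : IsProjection (e * (1 - s)) := by
    rw [mul_sub, mul_one]
    exact proj_sub p1 pe (by rw [mul_assoc, hse, ← mul_assoc, pe.2])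
  have oe : e * s * (e * (1 - s)) = 0 := by
    rw [mul_assoc, ← mul_assoc s, hse, mul_assoc, mul_sub, hs.2]; simp
  have ee : e * s + e * (1 - s) = e := by rw [mul_sub]; simp
  set g := e * (1 - s) with hg
  have hge : g * e = g := by
    have h3 : e * g = g := by rw [hg, ← mul_assoc, pe.2]
    simpa [pe.1, p2.1] using congrArg star h3
  have hgf : g * f = 0 := orth_symm pf p2 h1
  have S1 : ProjSubEquiv (e * s) f :=
    ⟨f * s, pfs, by show f * s * f = f * s; rw [mul_assoc, hsf, ← mul_assoc, pf.2], hE⟩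
  have S2 : ProjSubEquiv g f := by
    have : ∀ i : S, ∃ h, IsProjection h ∧ h * (i.1 * f) = h ∧ ProjEquiv (i.1 * g) h := by
      intro i
      have hz := (hS i).1
      exact sub_trans (cproj_mul hz p2) (cproj_mul hz pe) (cproj_mul hz pf)
        (sub_cut hz (sub_of_le p2 hge)) (hS i).2
    choose h hh hhl hhe using this
    obtain ⟨H, hH⟩ := psum_exists hAW h
    have hr : ∀ j, h j = j.1 * f * h j := fun j =>
      (le_symm (hh j) (cproj_mul (hS j).1 pf) (hhl j)).symm
    have hr2 : ∀ j, h j = f * h j := fun j => by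
      have h3 : f * (j.1 * f) = j.1 * f := by rw [← mul_assoc, ← (hS j).1.2, mul_assoc, pf.2]
      rw [hr, ← mul_assoc f, h3]
    refine ⟨H, hH.1, psum_le hH fun j => ?_, ?_⟩
    · have := congrArg star (hr2 j)
      rw [star_mul, (hh j).1, pf.1] at this
      exact this.symm
    · refine add_orth hAW (fun i => cproj_mul (hS i).1 p2) hh (fun i j hij => ?_) (fun i j hij => ?_)
        (fun i j => ?_) hhe (hSs g p2 hge) hH
      · show i.1 * g * (j.1 * g) = 0
        rw [(hS i).1.2, mul_assoc, ← mul_assoc i.1, hSo i j hij]; simp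
      · have : h i * f * (i.1 * j.1) * (f * h j) = 0 := by rw [hSo i j hij]; simp
        rw [← hhl i, hr j, (hS i).1.2, ← this]; noncomm_ring
      · rw [hr2 j, ← mul_assoc, mul_assoc i.1, hgf]; simp
  obtain ⟨a, b, ha, hb, hab, habf, fa, fb⟩ := halving hAW hf.1
  have := sub_add p1 p2 ha hb oe hab (sub_trans p1 pf ha S1 (sub_of_eqv pf fa))
    (sub_trans p2 pf hb S2 (sub_of_eqv pf fb))
  rwa [ee, habf] at this

lemma main_sub (hAW : IsAWStarRing A) {e f ce cf : A} (he : Equidimensional e)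
    (hf : Equidimensional f) (hce : IsCentralCover e ce) (hcf : IsCentralCover f cf) :
    ProjSubEquiv e f ↔ ProjLE ce cf ∧ projDim e ≤ projDim f := by
  have pe := he.1.1
  have pf := hf.1.1
  constructor
  · intro h
    refine ⟨hce.2.2 cf hcf.1 ?_, dim_mono hAW pe he.1.2.1 hf h⟩
    obtain ⟨v, h1, h2⟩ := (sub_iff pe pf).1 h
    have hfc : f * cf = f := hcf.2.1
    have hv : cf * v = v := by rw [← h2, ← mul_assoc, hcf.1.2, hfc]
    show e * cf = e
    rw [← h1, mul_assoc, ← hcf.1.2, hv]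
  · rintro ⟨h, hd⟩
    refine global_sub hAW he hf (fun z hz hze hzf => hze ?_) hd
    have h : ce * cf = ce := h
    have h1 : e * ce = e := hce.2.1
    have h2 : cf * (1 - z) = cf := hcf.2.2 _ (central_one_sub hz) (by
      show f * (1 - z) = f
      rw [mul_sub, ← hz.2, hzf]; simp)
    have h3 : cf * z = 0 := by
      rw [mul_sub, mul_one, sub_eq_self] at h2; exact h2
    rw [hz.2, ← h1, ← h, mul_assoc, mul_assoc, h3]; simp

end AWS

end Part6

/-- For properly infinite equidimensional projections: `e ≼ f` iff
`c(e) ≤ c(f)` and `d(e) ≤ d(f)`; and `e ∼ f` iff `c(e) = c(f)` and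
`d(e) = d(f)`. -/
theorem subEquiv_iff_centralCover_le_and_projDim_le {A : Type u} [NormedRing A]
    [StarRing A] [CStarRing A] [NormedAlgebra ℂ A] [StarModule ℂ A] [CompleteSpace A]
    (hAW : IsAWStarRing A) (e f ce cf : A)
    (he : Equidimensional e) (hf : Equidimensional f)
    (hce : IsCentralCover e ce) (hcf : IsCentralCover f cf) :
    (ProjSubEquiv e f ↔ (ProjLE ce cf ∧ projDim e ≤ projDim f)) ∧
    (ProjEquiv e f ↔ (ce = cf ∧ projDim e = projDim f)) := by
  letI : CStarAlgebra A := { ‹NormedRing A›, ‹StarRing A›, ‹CStarRing A›, ‹NormedAlgebra ℂ A›,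
    ‹StarModule ℂ A›, ‹CompleteSpace A› with }
  have k1 := AWS.main_sub hAW he hf hce hcf
  have k2 := AWS.main_sub hAW hf he hcf hce
  refine ⟨k1, fun h => ?_, fun h => ?_⟩
  · have a1 := k1.1 (AWS.sub_of_eqv he.1.1 h)
    have a2 := k2.1 (AWS.sub_of_eqv hf.1.1 (AWS.eqv_symm h))
    exact ⟨AWS.le_antisymm' hce.1.1 hcf.1.1 a1.1 a2.1, le_antisymm a1.2 a2.2⟩
  · obtain ⟨h1, h2⟩ := h
    refine AWS.sb hAW he.1.1 hf.1.1 (k1.2 ⟨?_, h2.le⟩) (k2.2 ⟨?_, h2.ge⟩)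
    · rw [h1]; exact hcf.1.1.2
    · rw [h1]; exact hcf.1.1.2
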